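/- arXiv:1703.09406 — 2 statements merged into one kernel-verified Lean document; each statement's English description precedes it below -/
import Mathlib

section
/- Let n ∈ ℕ. For every computable graph machine 𝔐 with underlying vertex set G and every valid configuration f of 𝔐 of Turing degree 𝐟, the following are 𝐟^(n)-computable, uniformly in n: (i) the collection P_n(f) of all pairs (A, (B_i)_{i≤n}) such that A ⊆ G is finite and (B_i)_{i≤n} is an n-approximation of 𝔐 and f on A; and (ii) the function f_n := ⟨𝔐,f⟩(·,n). -/
open scoped Classical
noncomputable section

/-! ### Oracle computability, Turing reducibility, and the Turing jump -/

/-- Codes for partial functions computable relative to an oracle `O : ℕ → ℕ`. -/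
inductive OCode : Type
  | zero | succ | left | right | oracle
  | pair (a b : OCode)
  | comp (a b : OCode)
  | prec (a b : OCode)
  | rfind' (a : OCode)

/-- Evaluation of an oracle code relative to the oracle `O`. -/
def OCode.eval (O : ℕ → ℕ) : OCode → ℕ →. ℕ
  | .zero => pure 0
  | .succ => fun n => Part.some (n + 1)
  | .left => fun n => Part.some (Nat.unpair n).1
  | .right => fun n => Part.some (Nat.unpair n).2
  | .oracle => fun n => Part.some (O n)
  | .pair cf cg => fun n => Nat.pair <$> OCode.eval O cf n <*> OCode.eval O cg n
  | .comp cf cg => fun n => OCode.eval O cg n >>= OCode.eval O cf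
  | .prec cf cg =>
      Nat.unpaired fun a n =>
        n.rec (OCode.eval O cf a) fun y IH => do
          let i ← IH
          OCode.eval O cg (Nat.pair a (Nat.pair y i))
  | .rfind' cf =>
      Nat.unpaired fun a m =>
        (Nat.rfind fun n => (fun x => x = 0) <$> OCode.eval O cf (Nat.pair a (n + m))).map (· + m)

/-- A standard surjective decoding of natural numbers as oracle codes. -/
def OCode.ofNat : ℕ → OCode
  | 0 => .zero
  | 1 => .succ
  | 2 => .left
  | 3 => .right
  | 4 => .oracle
  | (n + 5) =>
    have h1 : (n / 4).unpair.1 < n + 5 :=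
      Nat.lt_succ_of_le (le_trans (Nat.unpair_left_le _)
        (le_trans (Nat.div_le_self n 4) (Nat.le_add_right n 4)))
    have h2 : (n / 4).unpair.2 < n + 5 :=
      Nat.lt_succ_of_le (le_trans (Nat.unpair_right_le _)
        (le_trans (Nat.div_le_self n 4) (Nat.le_add_right n 4)))
    match n % 4 with
    | 0 => .pair (OCode.ofNat (n / 4).unpair.1) (OCode.ofNat (n / 4).unpair.2)
    | 1 => .comp (OCode.ofNat (n / 4).unpair.1) (OCode.ofNat (n / 4).unpair.2)
    | 2 => .prec (OCode.ofNat (n / 4).unpair.1) (OCode.ofNat (n / 4).unpair.2)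
    | _ => .rfind' (OCode.ofNat (n / 4).unpair.1)

/-- `f` is Turing reducible to the oracle `g` (for total functions on `ℕ`). -/
def TuringLE (f g : ℕ → ℕ) : Prop :=
  ∃ c : OCode, ∀ n, c.eval g n = Part.some (f n)

/-- Turing equivalence of total functions on `ℕ`. -/
def TuringEq (f g : ℕ → ℕ) : Prop := TuringLE f g ∧ TuringLE g f

/-- The Turing jump of an oracle. -/
def tjump (O : ℕ → ℕ) : ℕ → ℕ :=
  fun e => if ((OCode.ofNat e).eval O e).Dom then 1 else 0

/-- The `n`-th iterate of the Turing jump. -/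
def tjumpIter (O : ℕ → ℕ) : ℕ → ℕ → ℕ
  | 0 => O
  | n + 1 => tjump (tjumpIter O n)

/-- `𝟎^(n)`, the `n`-th jump of the computable degree. -/
def zeroN (n : ℕ) : ℕ → ℕ := tjumpIter (fun _ => 0) n

/-- `𝟎'`, the degree of the halting problem. -/
def zeroJump : ℕ → ℕ := zeroN 1

/-- The effective join `⨁ₙ F^(n)`. -/
def omegaIter (F : ℕ → ℕ) : ℕ → ℕ := fun p => tjumpIter F p.unpair.1 p.unpair.2

/-- `𝟎^(ω)`, the effective join of all `𝟎^(n)`. -/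
def zeroOmega : ℕ → ℕ := omegaIter (fun _ => 0)

/-- The effective join of two oracles. -/
def oJoin (F G : ℕ → ℕ) : ℕ → ℕ :=
  fun k => if k % 2 = 0 then F (k / 2) else G (k / 2)

/-- The characteristic function of a set of naturals. -/
def charFun (X : Set ℕ) : ℕ → ℕ := fun k => if k ∈ X then 1 else 0

/-- Kleene bracket: the `e`-th computable partial function. -/
def phi (e : ℕ) : ℕ →. ℕ := (Denumerable.ofNat Nat.Partrec.Code e).eval

/-! ### Colored graphs -/

/-- A colored graph with vertices, labels and colors drawn from `ℕ`.
`E v w` is the (finite) set of colors of edges from `v` to `w`, and `gam` is the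
allowable colors function. -/
structure ColoredGraph where
  G : Set ℕ
  L : Set ℕ
  C : Set ℕ
  V : ℕ → ℕ
  E : ℕ → ℕ → Finset ℕ
  gam : ℕ → Finset ℕ
  V_mem : ∀ v ∈ G, V v ∈ L
  E_sub : ∀ v w : ℕ, (E v w : Set ℕ) ⊆ C
  gam_sub : ∀ l ∈ L, (gam l : Set ℕ) ⊆ C
  E_allowed : ∀ v ∈ G, ∀ w ∈ G, E v w ⊆ gam (V v) ∩ gam (V w)

/-- A computable colored graph. -/
def ColoredGraph.Computable' (g : ColoredGraph) : Prop :=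
  ComputablePred (· ∈ g.G) ∧ ComputablePred (· ∈ g.L) ∧ ComputablePred (· ∈ g.C) ∧
    Computable g.V ∧
    Computable (fun p : ℕ × ℕ => Encodable.encode (g.E p.1 p.2)) ∧
    Computable (fun l => Encodable.encode (g.gam l))

/-- A colored graph is finitary if its set of labels is finite. -/
def ColoredGraph.Finitary (g : ColoredGraph) : Prop := g.L.Finite

/-- The set of vertices incident to `v`. -/
def ColoredGraph.degSet (g : ColoredGraph) (v : ℕ) : Set ℕ :=
  {w ∈ g.G | g.E v w ≠ ∅ ∨ g.E w v ≠ ∅}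

/-- `g` has finite degree if every vertex has finitely many neighbours. -/
def ColoredGraph.FiniteDegree (g : ColoredGraph) : Prop :=
  ∀ v ∈ g.G, (g.degSet v).Finite

/-- The degree function of `g` (as a total function on `ℕ`). -/
def ColoredGraph.degFun (g : ColoredGraph) : ℕ → ℕ :=
  fun v => if v ∈ g.G then (g.degSet v).ncard else 0

/-- `g` has constant (finite) degree. -/
def ColoredGraph.ConstantDegree (g : ColoredGraph) : Prop :=
  ∃ d : ℕ, ∀ v ∈ g.G, (g.degSet v).Finite ∧ (g.degSet v).ncard = d

/-- Adjacency in the underlying graph. -/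
def ColoredGraph.Adj (g : ColoredGraph) (v w : ℕ) : Prop :=
  v ∈ g.G ∧ w ∈ g.G ∧ (g.E v w ≠ ∅ ∨ g.E w v ≠ ∅)

/-- `A` is a connected subset (the vertex set of a connected subgraph) of `g`. -/
def ColoredGraph.ConnectedSubset (g : ColoredGraph) (A : Set ℕ) : Prop :=
  A ⊆ g.G ∧ ∀ v ∈ A, ∀ w ∈ A,
    Relation.ReflTransGen (fun a b => g.Adj a b ∧ a ∈ A ∧ b ∈ A) v w

/-- The 1-neighborhood of a set of vertices. -/
def ColoredGraph.nbhd (g : ColoredGraph) (A : Set ℕ) : Set ℕ :=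
  A ∪ {v ∈ g.G | ∃ a ∈ A, g.E v a ≠ ∅ ∨ g.E a v ≠ ∅}

/-- Restriction of a colored graph to the induced subgraph on `B`. -/
def ColoredGraph.restrict (g : ColoredGraph) (B : Set ℕ) : ColoredGraph :=
  { g with
    G := g.G ∩ B
    V_mem := fun v hv => g.V_mem v hv.1
    E_allowed := fun v hv w hw => g.E_allowed v hv.1 w hw.1 }

/-! ### Graph Turing machines -/

/-- A configuration assigns to each vertex a finite set of (received) colored pulses,
a displayed alphabet symbol, and a state. -/
abbrev Config := ℕ → Finset ℕ × ℕ × ℕ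

/-- A graph Turing machine. -/
structure GraphMachine where
  graph : ColoredGraph
  A : Finset ℕ
  zero_mem : 0 ∈ A
  one_mem : 1 ∈ A
  S : Set ℕ
  s : ℕ
  alpha : ℕ → Finset ℕ
  T : ℕ → Finset ℕ → ℕ → ℕ → Finset ℕ × ℕ × ℕ
  alpha_sub : ∀ l ∈ graph.L, (alpha l : Set ℕ) ⊆ S
  s_mem : ∀ l ∈ graph.L, s ∈ alpha l
  T_trivial : ∀ l c z t, (¬ c ⊆ graph.gam l ∨ t ∉ alpha l) → T l c z t = (c, z, t)
  T_compat : ∀ l c z t, t ∈ alpha l → c ⊆ graph.gam l → z ∈ A →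
    (T l c z t).1 ⊆ graph.gam l ∧ (T l c z t).2.1 ∈ A ∧ (T l c z t).2.2 ∈ alpha l
  T_init : ∀ l, T l ∅ 0 s = (∅, 0, s)

/-- A computable graph machine. -/
def GraphMachine.Computable' (M : GraphMachine) : Prop :=
  M.graph.Computable' ∧ ComputablePred (· ∈ M.S) ∧
    Computable (fun l => Encodable.encode (M.alpha l)) ∧
    Computable (fun q : ℕ × ℕ × ℕ × ℕ =>
      Encodable.encode
        (M.T q.1 ((Encodable.decode (α := Finset ℕ) q.2.1).getD ∅) q.2.2.1 q.2.2.2))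

/-- A valid configuration for `M`. -/
def GraphMachine.Valid (M : GraphMachine) (f : Config) : Prop :=
  ∀ v ∈ M.graph.G, (f v).1 ⊆ M.graph.gam (M.graph.V v) ∧
    (f v).2.2 ∈ M.alpha (M.graph.V v)

/-- The set of colored pulses received by `v` in one step from configuration `g`:
`⋃ w ∈ G, E w v ∩ (g w).1`. -/
def GraphMachine.pulses (M : GraphMachine) (g : Config) (v : ℕ) : Finset ℕ :=
  (M.graph.gam (M.graph.V v)).filter
    (fun c => ∃ w ∈ M.graph.G, c ∈ M.graph.E w v ∧ c ∈ (g w).1)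

/-- One step of the machine. -/
def GraphMachine.step (M : GraphMachine) (g : Config) : Config :=
  fun v => M.T (M.graph.V v) (M.pulses g v) (g v).2.1 (g v).2.2

/-- The run of `M` on configuration `f`: `M.run f n v = ⟨M,f⟩(v,n)`. -/
def GraphMachine.run (M : GraphMachine) (f : Config) : ℕ → Config
  | 0 => f
  | n + 1 => M.step (M.run f n)

/-- Restriction of a graph machine to the induced subgraph on `B`. -/
def GraphMachine.restrict (M : GraphMachine) (B : Set ℕ) : GraphMachine :=
  { M with graph := M.graph.restrict B }

/-- The restriction `f|_B` of a configuration (trivial data outside `B`). -/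
def restrictConfig (M : GraphMachine) (f : Config) (B : Set ℕ) : Config :=
  fun v => if v ∈ B then f v else (∅, 0, M.s)

/-- The run of `M` on `f` halts at stage `n`. -/
def GraphMachine.HaltsAt (M : GraphMachine) (f : Config) (n : ℕ) : Prop :=
  ∀ v ∈ M.graph.G, M.run f (n + 1) v = M.run f n v

/-- The run of `M` on `f` halts. -/
def GraphMachine.Halts (M : GraphMachine) (f : Config) : Prop :=
  ∃ n, M.HaltsAt f n

/-- The starting configuration determined by a display function `x`. -/
def GraphMachine.start (M : GraphMachine) (x : ℕ → ℕ) : Config :=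
  fun v => (∅, x v, M.s)

/-- `x ∈ 𝔄^{<G}`: alphabet values on `G`, zero off `G`, finite support. -/
def GraphMachine.InDom (M : GraphMachine) (x : ℕ → ℕ) : Prop :=
  (∀ v ∈ M.graph.G, x v ∈ M.A) ∧ (∀ v ∉ M.graph.G, x v = 0) ∧ {v | x v ≠ 0}.Finite

/-- The displayed symbols at the (first) halting stage of the run on `x̂`. -/
def GraphMachine.outputAt (M : GraphMachine) (x : ℕ → ℕ) : ℕ → ℕ :=
  fun v => (M.run (M.start x) (sInf {n | M.HaltsAt (M.start x) n}) v).2.1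

/-- `{M}` is total. -/
def GraphMachine.Total (M : GraphMachine) : Prop :=
  ∀ x, M.InDom x → M.Halts (M.start x)

/-- Decoding a natural number as a finitely supported function `ℕ → ℕ`. -/
def decodeFS (n : ℕ) : ℕ → ℕ := fun v => (Denumerable.ofNat (List ℕ) n).getD v 0

/-- The function `{M}` as a total function on `ℕ` (input: code of a finitely
supported display function paired with a vertex of `G`). -/
def GraphMachine.fn (M : GraphMachine) : ℕ → ℕ := fun p =>
  if M.InDom (decodeFS p.unpair.1) ∧ M.Halts (M.start (decodeFS p.unpair.1)) ∧
      p.unpair.2 ∈ M.graph.G then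
    M.outputAt (decodeFS p.unpair.1) p.unpair.2
  else 0

/-- The restriction `x|_X` (zero outside `X`). -/
def restrictTo (X : Set ℕ) (x : ℕ → ℕ) : ℕ → ℕ :=
  fun v => if v ∈ X then x v else 0

/-- `ζ : 𝔄^{<X} → 𝔄^X` is `⟨𝒢,X⟩`-computable via `M`. -/
def GraphMachine.ComputesVia (M : GraphMachine) (X : Set ℕ) (ζ : (ℕ → ℕ) → ℕ → ℕ) :
    Prop :=
  (∀ x, M.InDom x → M.Halts (M.start x)) ∧
  (∀ x y, M.InDom x → M.InDom y → restrictTo X x = restrictTo X y →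
      ∀ v ∈ M.graph.G, M.outputAt x v = M.outputAt y v) ∧
  (∀ x, M.InDom x → ∀ v ∈ M.graph.G, v ∉ X → M.outputAt x v = 0) ∧
  (∀ x, M.InDom x → ∀ v ∈ X, M.outputAt x v = ζ (restrictTo X x) v)

/-- `ζ` is `⟨𝒢,X⟩`-computable via the computable machine `M`, where `X` is an
infinite computable subset of `G`. -/
def GraphComputableVia (M : GraphMachine) (X : Set ℕ) (ζ : (ℕ → ℕ) → ℕ → ℕ) : Prop :=
  M.Computable' ∧ X.Infinite ∧ ComputablePred (· ∈ X) ∧ X ⊆ M.graph.G ∧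
    M.ComputesVia X ζ

/-- `ζ` as a total function on `ℕ`. -/
def zetaFn (M : GraphMachine) (X : Set ℕ) (ζ : (ℕ → ℕ) → ℕ → ℕ) : ℕ → ℕ := fun p =>
  if (∀ v ∈ X, decodeFS p.unpair.1 v ∈ M.A) ∧ (∀ v ∉ X, decodeFS p.unpair.1 v = 0) ∧
      p.unpair.2 ∈ X then
    ζ (decodeFS p.unpair.1) p.unpair.2
  else 0

/-- A configuration as a total function on `ℕ` (to serve as a Turing oracle). -/
def configFn (f : Config) : ℕ → ℕ := fun v => Encodable.encode (f v)

/-- The run of `M` on `f` as a total function on `ℕ`. -/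
def runFn (M : GraphMachine) (f : Config) : ℕ → ℕ := fun p =>
  if p.unpair.1 ∈ M.graph.G then Encodable.encode (M.run f p.unpair.2 p.unpair.1) else 0

/-- A function `Finset ℕ → Finset ℕ` as a total function on `ℕ`. -/
def finsetFn (Θ : Finset ℕ → Finset ℕ) : ℕ → ℕ := fun k =>
  Encodable.encode (Θ ((Encodable.decode (α := Finset ℕ) k).getD ∅))

/-- `(B i)_{i ≤ n}` is an `n`-approximation of `M` and `f` on `A`. -/
def IsApprox (M : GraphMachine) (f : Config) (n : ℕ) (B : ℕ → Set ℕ) (A : Set ℕ) :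
    Prop :=
  B 0 = A ∧ (∀ i ≤ n, B i ⊆ M.graph.G) ∧ (∀ i < n, B i ⊆ B (i + 1)) ∧
  ∀ i < n, ∀ B' : Set ℕ, B (i + 1) ⊆ B' → B' ⊆ M.graph.G →
    ∀ v ∈ B (i + 1),
      (M.restrict (B (i + 1))).run (restrictConfig M (M.run f i) (B (i + 1))) 1 v =
        (M.restrict B').run (restrictConfig M (M.run f i) B') 1 v

/-- The characteristic function of the collection `P n f` of `n`-approximations,
as a function on (codes of) pairs `(A, (B i)_{i ≤ n})` of finite sets. -/
def approxChar (M : GraphMachine) (f : Config) (n : ℕ) : ℕ → ℕ := fun k =>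
  match Encodable.decode (α := Finset ℕ × List (Finset ℕ)) k with
  | some p =>
      if p.2.length = n + 1 ∧ ↑p.1 ⊆ M.graph.G ∧
          IsApprox M f n (fun i => ↑(p.2.getD i ∅)) ↑p.1 then 1 else 0
  | none => 0

/-- `Θ` is a uniform approximation of `M`. -/
def UniformApprox (M : GraphMachine) (Θ : Finset ℕ → Finset ℕ) : Prop :=
  ∀ A : Finset ℕ, ↑A ⊆ M.graph.G →
    A ⊆ Θ A ∧ ↑(Θ A) ⊆ M.graph.G ∧
      ∀ f : Config, M.Valid f →
        IsApprox M f 1 (fun i => if i = 0 then (↑A : Set ℕ) else ↑(Θ A)) ↑A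

/-- `M` halts within `c` steps on every starting configuration supported on a
finite connected subgraph. -/
def GraphMachine.HaltsWithin (M : GraphMachine) (c : ℕ) : Prop :=
  ∀ A : Set ℕ, A.Finite → M.graph.ConnectedSubset A →
    ∀ x : ℕ → ℕ, M.InDom x → (∀ v ∉ A, x v = 0) → M.HaltsAt (M.start x) c

/-- `M` runs in linear space. -/
def GraphMachine.RunsInLinearSpace (M : GraphMachine) : Prop :=
  M.Total ∧ ∃ a b c d : ℕ,
    ∀ A : Set ℕ, A.Finite → M.graph.ConnectedSubset A →
      ∀ x : ℕ → ℕ, M.InDom x → (∀ v ∉ A, x v = 0) →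
        (M.graph.nbhd^[a * A.ncard + b] A).encard ≤ (c * A.ncard + d : ℕ) ∧
        ∀ v ∈ A, ∀ n : ℕ,
          M.run (M.start x) n v =
            (M.restrict (M.graph.nbhd^[a * A.ncard + b] A)).run
              (restrictConfig M (M.start x) (M.graph.nbhd^[a * A.ncard + b] A)) n v

/-! ### Iterated limits -/

/-- `lim_{k→∞} u k = a` for `ℕ`-valued sequences (eventual constancy). -/
def EvLim (u : ℕ → ℕ) (a : ℕ) : Prop := ∃ N, ∀ k ≥ N, u k = a

/-- `IterLim n F a`: the `n`-fold iterated limit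
`lim_{x₀→∞} ⋯ lim_{x_{n-1}→∞} F (x₀, …, x_{n-1})` exists and equals `a`. -/
def IterLim : (n : ℕ) → ((Fin n → ℕ) → ℕ) → ℕ → Prop
  | 0, F, a => F (fun i => i.elim0) = a
  | n + 1, F, a =>
      ∃ u : ℕ → ℕ, (∀ x, IterLim n (fun xs => F (Fin.cons x xs)) (u x)) ∧ EvLim u a

/-- `X` is `k`-computably enumerable (as a `{0,1}`-valued function `X : ℕ → ℕ`). -/
def KCE (X : ℕ → ℕ) (k : ℕ) : Prop :=
  ∃ g : ℕ → ℕ → ℕ, Computable₂ g ∧ (∀ n m, g n m ≤ 1) ∧ (∀ m, g 0 m = 0) ∧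
    (∀ m, ∃ N, ∀ n ≥ N, g n m = X m) ∧
    (∀ m, {l : ℕ | g l m ≠ g (l + 1) m}.encard ≤ (k : ℕ∞))



namespace GTM

/-! ### Basic facts on oracle codes -/

@[simp] theorem eval_zero (O n) : OCode.zero.eval O n = Part.some 0 := rfl
@[simp] theorem eval_succ (O n) : OCode.succ.eval O n = Part.some (n + 1) := rfl
@[simp] theorem eval_left (O n) : OCode.left.eval O n = Part.some (Nat.unpair n).1 := rfl
@[simp] theorem eval_right (O n) : OCode.right.eval O n = Part.some (Nat.unpair n).2 := rfl
@[simp] theorem eval_oracle (O n) : OCode.oracle.eval O n = Part.some (O n) := rfl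

theorem eval_pair {O : ℕ → ℕ} {a b : OCode} {n x y : ℕ} (ha : a.eval O n = Part.some x)
    (hb : b.eval O n = Part.some y) : (OCode.pair a b).eval O n = Part.some (Nat.pair x y) := by
  simp [OCode.eval, ha, hb, Seq.seq]

theorem eval_comp {O : ℕ → ℕ} {a b : OCode} {n x : ℕ} (hb : b.eval O n = Part.some x) :
    (OCode.comp a b).eval O n = a.eval O x := by
  change (b.eval O n).bind (a.eval O) = _
  rw [hb]
  exact Part.bind_some _ _

/-- Plain codes as oracle codes. -/
def ofCode : Nat.Partrec.Code → OCode
  | .zero => .zero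
  | .succ => .succ
  | .left => .left
  | .right => .right
  | .pair a b => .pair (ofCode a) (ofCode b)
  | .comp a b => .comp (ofCode a) (ofCode b)
  | .prec a b => .prec (ofCode a) (ofCode b)
  | .rfind' a => .rfind' (ofCode a)

theorem eval_ofCode (O : ℕ → ℕ) (c : Nat.Partrec.Code) : (ofCode c).eval O = c.eval := by
  induction c with
  | zero => rfl
  | succ => rfl
  | left => rfl
  | right => rfl
  | pair a b ha hb => simp only [ofCode, OCode.eval, Nat.Partrec.Code.eval, ha, hb]; rfl
  | comp a b ha hb => simp only [ofCode, OCode.eval, Nat.Partrec.Code.eval, ha, hb]; rfl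
  | prec a b ha hb => simp only [ofCode, OCode.eval, Nat.Partrec.Code.eval, ha, hb]; rfl
  | rfind' a ha => simp only [ofCode, OCode.eval, Nat.Partrec.Code.eval, ha]; congr!

/-- Substituting a code for the oracle. -/
def osubst (d : OCode) : OCode → OCode
  | .zero => .zero
  | .succ => .succ
  | .left => .left
  | .right => .right
  | .oracle => d
  | .pair a b => .pair (osubst d a) (osubst d b)
  | .comp a b => .comp (osubst d a) (osubst d b)
  | .prec a b => .prec (osubst d a) (osubst d b)
  | .rfind' a => .rfind' (osubst d a)

theorem eval_osubst {O g : ℕ → ℕ} {d : OCode} (hd : ∀ x, d.eval O x = Part.some (g x))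
    (r : OCode) : (osubst d r).eval O = r.eval g := by
  induction r with
  | zero => rfl
  | succ => rfl
  | left => rfl
  | right => rfl
  | oracle => funext x; simp [osubst, hd]
  | pair a b ha hb => simp only [osubst, OCode.eval, ha, hb]; rfl
  | comp a b ha hb => simp only [osubst, OCode.eval, ha, hb]; rfl
  | prec a b ha hb => simp only [osubst, OCode.eval, ha, hb]; rfl
  | rfind' a ha => simp only [osubst, OCode.eval, ha]; rfl

/-! Indices. -/

/-- Indices of compound codes. -/
def idx (i a b : ℕ) : ℕ := 4 * Nat.pair a b + i + 5

theorem ofNat_pair (a b : ℕ) : OCode.ofNat (idx 0 a b) =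
    .pair (OCode.ofNat a) (OCode.ofNat b) := by
  rw [idx, OCode.ofNat]
  have h1 : (4 * Nat.pair a b + 0) % 4 = 0 := by omega
  have h2 : (4 * Nat.pair a b + 0) / 4 = Nat.pair a b := by omega
  simp [h1, h2]

theorem ofNat_comp (a b : ℕ) : OCode.ofNat (idx 1 a b) =
    .comp (OCode.ofNat a) (OCode.ofNat b) := by
  rw [idx, OCode.ofNat]
  have h1 : (4 * Nat.pair a b + 1) % 4 = 1 := by omega
  have h2 : (4 * Nat.pair a b + 1) / 4 = Nat.pair a b := by omega
  simp [h1, h2]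

theorem ofNat_prec (a b : ℕ) : OCode.ofNat (idx 2 a b) =
    .prec (OCode.ofNat a) (OCode.ofNat b) := by
  rw [idx, OCode.ofNat]
  have h1 : (4 * Nat.pair a b + 2) % 4 = 2 := by omega
  have h2 : (4 * Nat.pair a b + 2) / 4 = Nat.pair a b := by omega
  simp [h1, h2]

theorem ofNat_rfind (a : ℕ) : OCode.ofNat (idx 3 a 0) =
    .rfind' (OCode.ofNat a) := by
  rw [idx, OCode.ofNat]
  have h1 : (4 * Nat.pair a 0 + 3) % 4 = 3 := by omega
  have h2 : (4 * Nat.pair a 0 + 3) / 4 = Nat.pair a 0 := by omega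
  simp [h1, h2]

theorem primrec_idx {α : Type*} [Primcodable α] (i : ℕ) {f g : α → ℕ} (hf : Primrec f) (hg : Primrec g) :
    Primrec (fun n => idx i (f n) (g n)) :=
  Primrec.nat_add.comp (Primrec.nat_add.comp
    (Primrec.nat_mul.comp (Primrec.const 4) (Primrec₂.natPair.comp hf hg)) (Primrec.const i))
    (Primrec.const 5)

theorem exists_osubst_idx (r : OCode) :
    ∃ s : ℕ → ℕ, Primrec s ∧ ∀ e, OCode.ofNat (s e) = osubst (OCode.ofNat e) r := by
  induction r with
  | zero => exact ⟨fun _ => 0, Primrec.const _, fun e => by simp [OCode.ofNat, osubst]⟩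
  | succ => exact ⟨fun _ => 1, Primrec.const _, fun e => by simp [OCode.ofNat, osubst]⟩
  | left => exact ⟨fun _ => 2, Primrec.const _, fun e => by simp [OCode.ofNat, osubst]⟩
  | right => exact ⟨fun _ => 3, Primrec.const _, fun e => by simp [OCode.ofNat, osubst]⟩
  | oracle => exact ⟨fun e => e, Primrec.id, fun e => by simp [osubst]⟩
  | pair a b ha hb =>
    obtain ⟨f, hf, hf'⟩ := ha
    obtain ⟨g, hg, hg'⟩ := hb
    exact ⟨_, primrec_idx 0 hf hg, fun e => by
      simp only [osubst, ofNat_pair, hf', hg']⟩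
  | comp a b ha hb =>
    obtain ⟨f, hf, hf'⟩ := ha
    obtain ⟨g, hg, hg'⟩ := hb
    exact ⟨_, primrec_idx 1 hf hg, fun e => by
      simp only [osubst, ofNat_comp, hf', hg']⟩
  | prec a b ha hb =>
    obtain ⟨f, hf, hf'⟩ := ha
    obtain ⟨g, hg, hg'⟩ := hb
    exact ⟨_, primrec_idx 2 hf hg, fun e => by
      simp only [osubst, ofNat_prec, hf', hg']⟩
  | rfind' a ha =>
    obtain ⟨f, hf, hf'⟩ := ha
    exact ⟨_, primrec_idx 3 hf (Primrec.const 0), fun e => by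
      simp only [osubst, ofNat_rfind, hf']⟩

theorem exists_idx (r : OCode) : ∃ e, OCode.ofNat e = r := by
  obtain ⟨s, -, hs⟩ := exists_osubst_idx r
  refine ⟨s 4, ?_⟩
  rw [hs]
  have h4 : OCode.ofNat 4 = OCode.oracle := by simp [OCode.ofNat]
  rw [h4]
  clear hs
  induction r <;> simp_all [osubst]

/-- Index of a code for a constant function. -/
def constIdx : ℕ → ℕ
  | 0 => 0
  | n + 1 => idx 1 1 (constIdx n)

theorem constIdx_primrec : Primrec constIdx := by
  have h : Primrec (fun n : ℕ => Nat.rec (motive := fun _ => ℕ) 0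
      (fun _ i => idx 1 1 i) n) :=
    Primrec.nat_rec₁ 0 ((primrec_idx 1 (Primrec.const 1) Primrec.id).comp Primrec.snd)
  refine h.of_eq fun n => ?_
  induction n with
  | zero => rfl
  | succ n ih => simp only [constIdx, ← ih]

theorem eval_constIdx (O : ℕ → ℕ) (n x : ℕ) :
    (OCode.ofNat (constIdx n)).eval O x = Part.some n := by
  induction n with
  | zero => simp [constIdx, OCode.ofNat]
  | succ n ih =>
    rw [constIdx, ofNat_comp, eval_comp ih]
    simp [OCode.ofNat]

/-! ### Uniform relative computability in a context -/

variable {K : Type*} {D : K → ℕ → ℕ} {e : K → ℕ}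
variable {α β δ : Type*} [Primcodable α] [Primcodable β] [Primcodable δ]

/-- `F` is computable uniformly in `k : K`, with oracle `D k` and extra parameter `e k`. -/
def OC (D : K → ℕ → ℕ) (e : K → ℕ) (F : K → α → β) : Prop :=
  ∃ c : OCode, ∀ k a, c.eval (D k) (Nat.pair (e k) (Encodable.encode a)) =
    Part.some (Encodable.encode (F k a))

theorem OC.of_computable {f : α → β} (hf : Computable f) : OC D e (fun _ a => f a) := by
  obtain ⟨c, hc⟩ := Nat.Partrec.Code.exists_code.1 hf
  refine ⟨.comp (ofCode c) .right, fun k a => ?_⟩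
  rw [eval_comp (eval_right _ _), eval_ofCode, hc]
  simp

theorem OC.comp {F : K → β → δ} {G : K → α → β} (hF : OC D e F) (hG : OC D e G) :
    OC D e (fun k a => F k (G k a)) := by
  obtain ⟨c, hc⟩ := hF
  obtain ⟨d, hd⟩ := hG
  refine ⟨.comp c (.pair .left d), fun k a => ?_⟩
  rw [eval_comp (eval_pair (eval_left _ _) (hd k a))]
  simp [hc]

theorem OC.pair {F : K → α → β} {G : K → α → δ} (hF : OC D e F) (hG : OC D e G) :
    OC D e (fun k a => (F k a, G k a)) := by
  obtain ⟨c, hc⟩ := hF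
  obtain ⟨d, hd⟩ := hG
  exact ⟨.pair c d, fun k a => eval_pair (hc k a) (hd k a)⟩

theorem OC.cc {f : β → δ} {G : K → α → β} (hf : Computable f) (hG : OC D e G) :
    OC D e (fun k a => f (G k a)) := OC.comp (OC.of_computable hf) hG

theorem OC.cc₂ {γ : Type*} [Primcodable γ] {f : β → δ → γ} {F : K → α → β} {G : K → α → δ}
    (hf : Computable₂ f) (hF : OC D e F) (hG : OC D e G) :
    OC D e (fun k a => f (F k a) (G k a)) :=
  OC.comp (F := fun _ (p : β × δ) => f p.1 p.2) (OC.of_computable hf) (hF.pair hG)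

theorem OC.param : OC D e (fun k (_ : α) => e k) :=
  ⟨.left, fun k a => by simp⟩

theorem OC.const (b : β) : OC D e (fun _ (_ : α) => b) := OC.of_computable (Computable.const b)

theorem OC.id : OC D e (fun _ (a : α) => a) := OC.of_computable Computable.id

theorem OC.oracle {G : K → α → ℕ} (hG : OC D e G) : OC D e (fun k a => D k (G k a)) := by
  obtain ⟨d, hd⟩ := hG
  refine ⟨.comp .oracle d, fun k a => ?_⟩
  rw [eval_comp (hd k a)]
  simp

/-- Decidable predicates. -/
def OCP (D : K → ℕ → ℕ) (e : K → ℕ) (P : K → α → Prop) : Prop :=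
  OC D e (fun k a => if P k a then 1 else 0)

theorem OCP.of_eq {P Q : K → α → Prop} (hP : OCP D e P) (h : ∀ k a, P k a ↔ Q k a) :
    OCP D e Q := by
  have : P = Q := by funext k a; exact propext (h k a)
  exact this ▸ hP

theorem OC.of_eq {P Q : K → α → β} (hP : OC D e P) (h : ∀ k a, P k a = Q k a) :
    OC D e Q := by
  have : P = Q := by funext k a; exact h k a
  exact this ▸ hP

theorem OCP.comp {P : K → β → Prop} {G : K → α → β} (hP : OCP D e P) (hG : OC D e G) :
    OCP D e (fun k a => P k (G k a)) :=
  OC.comp (F := fun k a => if P k a then 1 else 0) hP hG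

theorem OCP.of_computable {p : α → Prop} (hp : ComputablePred p) :
    OCP D e (fun _ a => p a) := by
  obtain ⟨i, hp⟩ := hp
  have : Computable (fun a => cond (decide (p a)) 1 0) :=
    Computable.cond hp (Computable.const 1) (Computable.const 0)
  refine (OC.of_computable this).of_eq fun k a => ?_
  by_cases h : p a <;> simp [h]

theorem OCP.not {P : K → α → Prop} (hP : OCP D e P) : OCP D e (fun k a => ¬ P k a) := by
  have : Computable (fun n : ℕ => 1 - n) :=
    (Primrec.nat_sub.comp (Primrec.const 1) Primrec.id).to_comp
  refine (OC.cc this hP).of_eq fun k a => ?_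
  by_cases h : P k a <;> simp [h]

theorem OCP.and {P Q : K → α → Prop} (hP : OCP D e P) (hQ : OCP D e Q) :
    OCP D e (fun k a => P k a ∧ Q k a) := by
  refine (OC.cc₂ Primrec.nat_mul.to_comp hP hQ).of_eq fun k a => ?_
  by_cases h : P k a <;> by_cases h' : Q k a <;> simp [h, h']

theorem OCP.or {P Q : K → α → Prop} (hP : OCP D e P) (hQ : OCP D e Q) :
    OCP D e (fun k a => P k a ∨ Q k a) :=
  (hP.not.and hQ.not).not.of_eq fun k a => by tauto

theorem OCP.imp {P Q : K → α → Prop} (hP : OCP D e P) (hQ : OCP D e Q) :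
    OCP D e (fun k a => P k a → Q k a) :=
  (hP.not.or hQ).of_eq fun k a => by tauto

theorem OCP.iff {P Q : K → α → Prop} (hP : OCP D e P) (hQ : OCP D e Q) :
    OCP D e (fun k a => P k a ↔ Q k a) :=
  ((hP.imp hQ).and (hQ.imp hP)).of_eq fun k a => by tauto

theorem OCP.eq {F G : K → α → ℕ} (hF : OC D e F) (hG : OC D e G) :
    OCP D e (fun k a => F k a = G k a) := by
  have : ComputablePred (fun p : ℕ × ℕ => p.1 = p.2) := (Primrec.eq (α := ℕ)).computablePred
  exact OCP.comp (OCP.of_computable this) (hF.pair hG)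

theorem OCP.lt {F G : K → α → ℕ} (hF : OC D e F) (hG : OC D e G) :
    OCP D e (fun k a => F k a < G k a) := by
  have : ComputablePred (fun p : ℕ × ℕ => p.1 < p.2) := Primrec.nat_lt.computablePred
  exact OCP.comp (OCP.of_computable this) (hF.pair hG)

theorem OC.ite {P : K → α → Prop} [∀ k a, Decidable (P k a)] {F G : K → α → β} (hP : OCP D e P) (hF : OC D e F)
    (hG : OC D e G) : OC D e (fun k a => if P k a then F k a else G k a) := by
  have h0 : Computable (fun p : ℕ × β × β => cond (decide (p.1 = 1)) p.2.1 p.2.2) :=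
    Computable.cond ((Primrec.eq.comp Primrec.fst (Primrec.const 1)).decide.to_comp)
      (Computable.fst.comp Computable.snd) (Computable.snd.comp Computable.snd)
  refine (OC.cc h0 (OC.pair hP (hF.pair hG))).of_eq fun k a => ?_
  by_cases h : P k a <;> simp [h]

theorem rfind_eval (O : ℕ → ℕ) (c : OCode) (p : ℕ → Prop) (a : ℕ)
    (hc : ∀ y, c.eval O (Nat.pair a y) = Part.some (if p y then 0 else 1)) :
    (OCode.rfind' c).eval O (Nat.pair a 0) =
      Nat.rfind (fun y => Part.some (decide (p y))) := by
  have h1 : (OCode.rfind' c).eval O (Nat.pair a 0) = (Nat.rfind fun n =>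
      (fun x => decide (x = 0)) <$> OCode.eval O c (Nat.pair a (n + 0))).map (· + 0) := by
    simp only [OCode.eval, Nat.unpaired, Nat.unpair_pair]
  have h2 : (fun n => (fun x => decide (x = 0)) <$> OCode.eval O c (Nat.pair a (n + 0))) =
      (fun y => Part.some (decide (p y))) := by
    funext y
    rw [add_zero, hc]
    by_cases h : p y <;> simp [h]
  rw [h1, h2]
  simp [Part.map_id']

theorem rfind_dom (O : ℕ → ℕ) (c : OCode) (p : ℕ → Prop) (a : ℕ)
    (hc : ∀ y, c.eval O (Nat.pair a y) = Part.some (if p y then 0 else 1)) :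
    ((OCode.rfind' c).eval O (Nat.pair a 0)).Dom ↔ ∃ y, p y := by
  rw [rfind_eval O c p a hc]
  refine Nat.rfind_dom.trans ?_
  simp

theorem rfind_find (O : ℕ → ℕ) (c : OCode) (p : ℕ → Prop) (a : ℕ)
    (hc : ∀ y, c.eval O (Nat.pair a y) = Part.some (if p y then 0 else 1)) (h : ∃ y, p y) :
    (OCode.rfind' c).eval O (Nat.pair a 0) = Part.some (Nat.find h) := by
  rw [rfind_eval O c p a hc, Part.eq_some_iff]
  refine Nat.mem_rfind.2 ⟨by simpa using Nat.find_spec h, fun {m} hm => ?_⟩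
  simpa using Nat.find_min h hm

/-- A code testing `P` on pairs, in the form needed by unbounded search. -/
theorem OCP.test {P : K → α × ℕ → Prop} (hP : OCP D e P) :
    ∃ c : OCode, ∀ k a y, c.eval (D k) (Nat.pair (Nat.pair (e k) (Encodable.encode a)) y) =
      Part.some (if P k (a, y) then 0 else 1) := by
  obtain ⟨c, hc⟩ := hP.not
  refine ⟨.comp c (.pair (.comp .left .left) (.pair (.comp .right .left) .right)),
    fun k a y => ?_⟩
  have h1 : ∀ O x, (OCode.comp .left .left).eval O x = Part.some x.unpair.1.unpair.1 :=
    fun O x => by rw [eval_comp (eval_left _ _)]; simp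
  have h2 : ∀ O x, (OCode.comp .right .left).eval O x = Part.some x.unpair.1.unpair.2 :=
    fun O x => by rw [eval_comp (eval_left _ _)]; simp
  rw [eval_comp (eval_pair (h1 _ _) (eval_pair (h2 _ _) (eval_right _ _)))]
  have := hc k (a, y)
  simp only [Encodable.encode_prod_val, Encodable.encode_nat] at this
  simp only [Nat.unpair_pair, this]
  by_cases h : P k (a, y) <;> simp [h]

theorem OC.search {P : K → α × ℕ → Prop} (hP : OCP D e P) (h : ∀ k a, ∃ y, P k (a, y))
    {W : K → α × ℕ → β} (hW : OC D e W) {F : K → α → β}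
    (hF : ∀ k a y, P k (a, y) → (∀ z < y, ¬ P k (a, z)) → W k (a, y) = F k a) :
    OC D e F := by
  obtain ⟨c, hc⟩ := hP.test
  have : OC D e (fun k a => Nat.find (h k a)) := by
    refine ⟨.comp (.rfind' c) (.pair (.pair .left .right) .zero), fun k a => ?_⟩
    rw [eval_comp (eval_pair (eval_pair (eval_left _ _) (eval_right _ _)) (eval_zero _ _))]
    simp only [Nat.unpair_pair]
    rw [rfind_find _ c _ _ (hc k a) (h k a)]
    rfl
  refine (OC.comp hW (OC.id.pair this)).of_eq fun k a => ?_
  exact hF k a _ (Nat.find_spec (h k a)) fun z hz => Nat.find_min (h k a) hz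

theorem OCP.ball {P : K → α × ℕ → Prop} {b : K → α → ℕ} (hb : OC D e b) (hP : OCP D e P) :
    OCP D e (fun k a => ∀ y < b k a, P k (a, y)) := by
  have hb' : OC D e (fun k (p : α × ℕ) => b k p.1) := hb.comp (OC.of_computable Computable.fst)
  have h2 : OC D e (fun k (p : α × ℕ) => p.2) := OC.of_computable Computable.snd
  have h3 : OCP D e (fun k (p : α × ℕ) => ¬ p.2 < b k p.1) := (OCP.lt h2 hb').not
  refine OC.search (P := fun k p => ¬ p.2 < b k p.1 ∨ ¬ P k p) (h3.or hP.not)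
    (fun k a => ⟨b k a, Or.inl (lt_irrefl _)⟩) h3 fun k a y hy hz => ?_
  have : (¬ y < b k a) ↔ ∀ y < b k a, P k (a, y) := by
    constructor
    · intro h x hx
      have := hz x (by omega)
      tauto
    · intro h h'
      rcases hy with hy | hy
      · exact hy h'
      · exact hy (h y h')
  by_cases hq : ∀ y < b k a, P k (a, y)
  · rw [if_pos hq]; exact if_pos (this.2 hq)
  · rw [if_neg hq]; exact if_neg fun h => hq (this.1 h)

theorem OCP.bex {P : K → α × ℕ → Prop} {b : K → α → ℕ} (hb : OC D e b) (hP : OCP D e P) :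
    OCP D e (fun k a => ∃ y < b k a, P k (a, y)) :=
  (OCP.ball hb hP.not).not.of_eq fun k a => by push Not; rfl

/-! ### The jump -/

/-- Contexts for relativized computations. -/
structure JCtx where
  O : ℕ → ℕ
  e : ℕ
  g : ℕ → ℕ
  h : ∀ x, (OCode.ofNat e).eval O x = Part.some (g x)

/-- Computable from `tjump O`, uniformly in an index `e` with `g = {e}^O`. -/
abbrev OCJ (F : JCtx → α → β) : Prop := OC (fun k : JCtx => tjump k.O) (fun k => k.e) F

abbrev OCPJ (F : JCtx → α → Prop) : Prop := OCP (fun k : JCtx => tjump k.O) (fun k => k.e) F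

/-- Computable from `g`, uniformly. -/
abbrev OCG (F : (ℕ → ℕ) → α → β) : Prop := OC (fun g => g) (fun _ => 0) F

abbrev OCPG (F : (ℕ → ℕ) → α → Prop) : Prop := OCP (fun g => g) (fun _ => 0) F

theorem OCPJ.query {P : (ℕ → ℕ) → α × ℕ → Prop} (hP : OCPG P) :
    OCPJ (fun k (a : α) => ∃ y, P k.g (a, y)) := by
  obtain ⟨c, hc⟩ := hP.test
  obtain ⟨s, hs, hs'⟩ := exists_osubst_idx (.rfind' c)
  have hj : Computable (fun p : ℕ × α =>
      idx 1 (s p.1) (constIdx (Nat.pair (Nat.pair 0 (Encodable.encode p.2)) 0))) :=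
    (primrec_idx 1 (hs.comp Primrec.fst)
        (constIdx_primrec.comp (Primrec₂.natPair.comp (Primrec₂.natPair.comp (Primrec.const 0)
          (Primrec.encode.comp Primrec.snd)) (Primrec.const 0)))).to_comp
  refine (OC.oracle (OC.cc hj (OC.param.pair OC.id))).of_eq fun k a => ?_
  simp only [tjump]
  congr 1
  rw [ofNat_comp, hs', eval_comp (eval_constIdx _ _ _), eval_osubst k.h,
    rfind_dom _ c _ _ (hc k.g a)]

theorem OCJ.value : OCJ (fun k (x : ℕ) => k.g x) := by
  have h1 : OCPG (fun g (p : (ℕ × ℕ) × ℕ) => g p.1.1 = p.1.2) :=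
    OCP.eq (OC.oracle (OC.of_computable (Computable.fst.comp Computable.fst)))
      (OC.of_computable (Computable.snd.comp Computable.fst))
  have h2 := OCPJ.query h1
  refine OC.search (h2.of_eq (Q := fun k p => k.g p.1 = p.2) fun k a => by simp)
    (fun k a => ⟨_, rfl⟩) (OC.of_computable Computable.snd) fun k a y hy _ => hy.symm

/-! ### Iteration -/

theorem iterate {S : (ℕ → ℕ) → ℕ → ℕ} (hS : OCJ (fun k x => S k.g x)) (O : ℕ → ℕ)
    (H : ℕ → ℕ → ℕ) (hH : ∀ n, H (n + 1) = S (H n)) (c₀ : OCode)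
    (hc₀ : ∀ O' x, ∃ y, c₀.eval O' x = Part.some y)
    (h0 : ∀ x, c₀.eval O x = Part.some (H 0 x)) :
    OC (fun n => tjumpIter O n) (fun n => n) H := by
  obtain ⟨c₁, hc₁⟩ := hS
  obtain ⟨e₀, he₀⟩ := exists_idx c₀
  obtain ⟨e₁, he₁⟩ := exists_idx c₁
  obtain ⟨ei, hei⟩ := exists_idx (.pair .left .right)
  let nx : ℕ → ℕ := fun e => idx 1 e₁ (idx 0 (constIdx e) ei)
  have hnx : Primrec nx := primrec_idx 1 (Primrec.const _)
    (primrec_idx 0 constIdx_primrec (Primrec.const _))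
  let E : ℕ → ℕ := fun n => Nat.rec (motive := fun _ => ℕ) e₀ (fun _ i => nx i) n
  have hE : Primrec E := Primrec.nat_rec₁ e₀ (hnx.comp Primrec.snd)
  have key : ∀ n x, (OCode.ofNat (E n)).eval (tjumpIter O n) x = Part.some (H n x) := by
    intro n
    induction n with
    | zero => intro x; simpa [E, he₀, tjumpIter] using h0 x
    | succ n ih =>
      intro x
      change (OCode.ofNat (nx (E n))).eval (tjumpIter O (n + 1)) x = _
      simp only [nx]
      have hp : ∀ O' x, (OCode.pair .left .right).eval O' x = Part.some x := fun O' x => by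
        rw [eval_pair (eval_left _ _) (eval_right _ _)]; simp
      rw [ofNat_comp, ofNat_pair, hei, he₁,
        eval_comp (eval_pair (eval_constIdx _ _ _) (hp _ _))]
      rw [hH]
      exact hc₁ ⟨tjumpIter O n, E n, H n, ih⟩ x
  have hpre : OC (fun n : ℕ => tjumpIter O n) (fun n => n)
      (fun n (x : ℕ) => (E (n - 1), x)) :=
    OC.pair (OC.cc (f := fun n => E (n - 1)) (hE.comp Primrec.pred).to_comp OC.param) OC.id
  obtain ⟨d, hd⟩ := hpre
  have hsg : OC (fun n : ℕ => tjumpIter O n) (fun n => n)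
      (fun n (x : ℕ) => 1 - (1 - n)) :=
    OC.cc (f := fun n => 1 - (1 - n)) (Primrec.nat_sub.comp (Primrec.const 1)
      (Primrec.nat_sub.comp (Primrec.const 1) Primrec.id)).to_comp OC.param
  obtain ⟨s, hs⟩ := hsg
  refine ⟨.comp (.prec (.comp c₀ .right) (.comp c₁ (.comp d .left)))
    (.pair (.pair .left .right) s), fun n x => ?_⟩
  rw [eval_comp (eval_pair (eval_pair (eval_left _ _) (eval_right _ _)) (hs n x))]
  cases n with
  | zero =>
    simp only [OCode.eval, Nat.unpaired, Nat.unpair_pair, Encodable.encode_nat]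
    exact (Part.bind_some _ _).trans (h0 x)
  | succ n =>
    have h1 : (1 - (1 - (n + 1))) = 1 := by omega
    obtain ⟨y, hy⟩ := hc₀ (tjumpIter O (n + 1)) x
    have h2 : ∀ i, (OCode.comp c₁ (.comp d .left)).eval (tjumpIter O (n + 1))
        (Nat.pair (Nat.pair (n + 1) x) i) = Part.some (H (n + 1) x) := by
      intro i
      have h3 : (OCode.comp d .left).eval (tjumpIter O (n + 1))
        (Nat.pair (Nat.pair (n + 1) x) i) = Part.some (Nat.pair (E n) x) := by
        rw [eval_comp (eval_left _ _)]
        simpa using hd (n + 1) x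
      rw [eval_comp h3, hH]
      exact hc₁ ⟨tjumpIter O n, E n, H n, key n⟩ x
    have h4 : (OCode.comp c₀ .right).eval (tjumpIter O (n + 1)) (Nat.pair (n + 1) x) =
        Part.some y := by
      rw [eval_comp (eval_right _ _)]; simpa using hy
    have h5 : ∀ (cf cg : OCode) O' a, (OCode.prec cf cg).eval O' (Nat.pair a 1) =
        (cf.eval O' a).bind fun i => cg.eval O' (Nat.pair a (Nat.pair 0 i)) := by
      intro cf cg O' a
      simp only [OCode.eval, Nat.unpaired, Nat.unpair_pair]
      rfl
    simp only [h1, Nat.unpair_pair, Encodable.encode_nat]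
    rw [h5, h4, Part.bind_some, h2]


/-! ### Finite sets of naturals via their codes -/

/-- The finite set with code `k`. -/
def fs (k : ℕ) : Finset ℕ := (Encodable.decode (α := Finset ℕ) k).getD ∅

/-- The list with code `k`. -/
def lst (k : ℕ) : List ℕ := Denumerable.ofNat (List ℕ) k

/-- `k` is a code for a finite set. -/
def Vld (k : ℕ) : Prop := (lst k).Nodup

theorem decode_multiset (k : ℕ) :
    Encodable.decode (α := Multiset ℕ) k = some (lst k : Multiset ℕ) := by
  change ((↑) : List ℕ → Multiset ℕ) <$> Encodable.decode (α := List ℕ) k = _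
  rw [Denumerable.decode_eq_ofNat]
  rfl

theorem decode_multiset_aux (k : ℕ) :
    decodeMultiset (α := ℕ) k = some (lst k : Multiset ℕ) := decode_multiset k

theorem decode_pos {k : ℕ} (h : Vld k) :
    Encodable.decode (α := Finset ℕ) k = some ⟨lst k, h⟩ := by
  have h' : (lst k : Multiset ℕ).Nodup := h
  refine (@Encodable.decode_ofEquiv _ _ (_) _ k).trans ?_
  simp only [Encodable.decode, Encodable.decodeSubtype, decode_multiset_aux]
  simp [h']

theorem decode_neg {k : ℕ} (h : ¬ Vld k) :
    Encodable.decode (α := Finset ℕ) k = none := by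
  have h' : ¬ (lst k : Multiset ℕ).Nodup := h
  refine (@Encodable.decode_ofEquiv _ _ (_) _ k).trans ?_
  simp only [Encodable.decode, Encodable.decodeSubtype, decode_multiset_aux]
  simp [h']

theorem decode_eq (k : ℕ) :
    Encodable.decode (α := Finset ℕ) k = if Vld k then some (fs k) else none := by
  by_cases h : Vld k
  · simp [h, fs, decode_pos h]
  · simp [h, decode_neg h]

theorem mem_fs {c k : ℕ} : c ∈ fs k ↔ Vld k ∧ c ∈ lst k := by
  by_cases h : Vld k
  · simp only [h, fs, decode_pos h, Option.getD_some, true_and]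
    exact Iff.rfl
  · simp [h, fs, decode_neg h]

theorem fs_encode (s : Finset ℕ) : fs (Encodable.encode s) = s := by
  simp [fs, Encodable.encodek]

theorem mem_lst_lt {c k : ℕ} (h : c ∈ lst k) : c < k := by
  have : k = Encodable.encode (lst k) := by simp [lst]
  rw [this]
  generalize lst k = l at h
  induction l with
  | nil => simp at h
  | cons a l ih =>
    rw [Encodable.encode_list_cons]
    rcases List.mem_cons.1 h with rfl | h
    · exact Nat.lt_succ_of_le (Nat.left_le_pair _ _)
    · exact Nat.lt_succ_of_le ((ih h).le.trans (Nat.right_le_pair _ _))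

theorem mem_fs_lt {c k : ℕ} (h : c ∈ fs k) : c < k := mem_lst_lt (mem_fs.1 h).2

theorem decode_list (k : ℕ) : Encodable.decode (α := List (Finset ℕ)) k =
    if ∀ m ∈ lst k, Vld m then some ((lst k).map fs) else none := by
  induction k using Nat.strong_induction_on with
  | _ k ih =>
    cases k with
    | zero => simp [lst]
    | succ k =>
      have h1 := ih k.unpair.2 (Nat.lt_succ_of_le (Nat.unpair_right_le k))
      have h2 : lst (k + 1) = k.unpair.1 :: lst k.unpair.2 := by
        simp [lst]
      rw [Encodable.decode_list_succ, h1, h2, decode_eq]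
      by_cases ha : Vld k.unpair.1 <;> by_cases hb : ∀ m ∈ lst k.unpair.2, Vld m <;>
        simp [ha, hb, Seq.seq]

theorem fs_zero : fs 0 = ∅ := by
  ext c
  simp [mem_fs, lst]

theorem getD_fs (l : List ℕ) (i : ℕ) : (l.map fs).getD i ∅ = fs (l.getD i 0) := by
  rw [← fs_zero, List.getD_map]

theorem lst_computable : Computable lst := Computable.ofNat _

theorem OCP.exists_lst {P : K → α × ℕ → Prop} {b : K → α → ℕ} (hb : OC D e b) (hP : OCP D e P) :
    OCP D e (fun k a => ∃ y ∈ lst (b k a), P k (a, y)) := by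
  have hl : OC D e (fun k a => lst (b k a)) := OC.cc lst_computable hb
  have hlen : OC D e (fun k a => (lst (b k a)).length) := OC.cc Computable.list_length hl
  have hget : OC D e (fun k (p : α × ℕ) => (lst (b k p.1)).getD p.2 0) :=
    OC.cc₂ (f := fun (l : List ℕ) n => l.getD n 0) (Primrec.list_getD 0).to_comp (hl.comp (OC.of_computable Computable.fst))
      (OC.of_computable Computable.snd)
  refine (OCP.bex hlen (hP.comp ((OC.of_computable Computable.fst).pair hget))).of_eq fun k a => ?_
  constructor
  · rintro ⟨i, hi, h⟩
    refine ⟨_, ?_, h⟩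
    simp [hi]
  · rintro ⟨y, hy, h⟩
    obtain ⟨i, hi, rfl⟩ := List.mem_iff_getElem.1 hy
    refine ⟨i, hi, ?_⟩
    simpa [hi] using h

theorem OCP.forall_lst {P : K → α × ℕ → Prop} {b : K → α → ℕ} (hb : OC D e b) (hP : OCP D e P) :
    OCP D e (fun k a => ∀ y ∈ lst (b k a), P k (a, y)) :=
  (OCP.exists_lst hb hP.not).not.of_eq fun k a => by push Not; rfl

theorem OCP.vld {b : K → α → ℕ} (hb : OC D e b) : OCP D e (fun k a => Vld (b k a)) := by
  suffices OCP D e (fun _ (n : ℕ) => Vld n) from this.comp hb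
  have hlen : OC D e (fun _ (n : ℕ) => (lst n).length) :=
    OC.cc Computable.list_length (OC.of_computable lst_computable)
  have hg1 : OC D e (fun _ (p : (ℕ × ℕ) × ℕ) => (lst p.1.1).getD p.1.2 0) :=
    OC.cc₂ (f := fun (l : List ℕ) n => l.getD n 0) (Primrec.list_getD 0).to_comp
      (OC.of_computable (lst_computable.comp (Computable.fst.comp Computable.fst)))
      (OC.of_computable (Computable.snd.comp Computable.fst))
  have hg2 : OC D e (fun _ (p : (ℕ × ℕ) × ℕ) => (lst p.1.1).getD p.2 0) :=
    OC.cc₂ (f := fun (l : List ℕ) n => l.getD n 0) (Primrec.list_getD 0).to_comp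
      (OC.of_computable (lst_computable.comp (Computable.fst.comp Computable.fst)))
      (OC.of_computable Computable.snd)
  refine (OCP.ball hlen (OCP.ball (OC.of_computable Computable.snd)
    (OCP.eq hg1 hg2).not)).of_eq fun _ n => ?_
  rw [Vld, List.nodup_iff_injective_getElem]
  constructor
  · intro h i j hij
    rcases lt_trichotomy i.1 j.1 with h' | h' | h'
    · exact absurd (by simpa using hij.symm) (h j j.2 i h')
    · exact Fin.ext h'
    · exact absurd (by simpa using hij) (h i i.2 j h')
  · intro h i hi j hj hij
    have hij' : (⟨i, hi⟩ : Fin (lst n).length) = ⟨j, by simp at hj; omega⟩ := by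
      apply h
      simp at hj
      have hj' : j < (lst n).length := by omega
      simpa [hi, hj'] using hij
    simp at hij' hj
    omega

theorem OCP.forall_fs {P : K → α × ℕ → Prop} {b : K → α → ℕ} (hb : OC D e b) (hP : OCP D e P) :
    OCP D e (fun k a => ∀ y ∈ fs (b k a), P k (a, y)) :=
  ((OCP.vld hb).imp (OCP.forall_lst hb hP)).of_eq fun k a => by
    simp only [mem_fs]; tauto

theorem OCP.exists_fs {P : K → α × ℕ → Prop} {b : K → α → ℕ} (hb : OC D e b) (hP : OCP D e P) :
    OCP D e (fun k a => ∃ y ∈ fs (b k a), P k (a, y)) :=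
  ((OCP.vld hb).and (OCP.exists_lst hb hP)).of_eq fun k a => by
    simp only [mem_fs]; tauto

theorem OCP.mem {b c : K → α → ℕ} (hc : OC D e c) (hb : OC D e b) :
    OCP D e (fun k a => c k a ∈ fs (b k a)) :=
  (OCP.exists_fs hb (P := fun k p => p.2 = c k p.1) (OCP.eq (OC.of_computable Computable.snd)
    (hc.comp (OC.of_computable Computable.fst)))).of_eq fun k a => by simp

theorem OC.v1 {F : K → α → β} (hF : OC D e F) : OC D e (fun k (p : α × ℕ) => F k p.1) :=
  hF.comp (OC.of_computable Computable.fst)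

theorem OC.v2 : OC D e (fun _ (p : α × ℕ) => p.2) := OC.of_computable Computable.snd

theorem OCP.subset {b c : K → α → ℕ} (hc : OC D e c) (hb : OC D e b) :
    OCP D e (fun k a => fs (c k a) ⊆ fs (b k a)) :=
  OCP.forall_fs (P := fun k p => p.2 ∈ fs (b k p.1)) hc (OCP.mem OC.v2 hb.v1)


/-! ### Graph machines -/

theorem OC.u1 {F : K → α → ℕ} (hF : OC D e F) : OC D e (fun k a => (F k a).unpair.1) :=
  OC.cc (f := fun n => (Nat.unpair n).1) (Primrec.fst.comp Primrec.unpair).to_comp hF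

theorem OC.u2 {F : K → α → ℕ} (hF : OC D e F) : OC D e (fun k a => (F k a).unpair.2) :=
  OC.cc (f := fun n => (Nat.unpair n).2) (Primrec.snd.comp Primrec.unpair).to_comp hF

theorem OC.np {F G : K → α → ℕ} (hF : OC D e F) (hG : OC D e G) :
    OC D e (fun k a => Nat.pair (F k a) (G k a)) :=
  OC.cc₂ Primrec₂.natPair.to_comp hF hG

/-- `w` sends the pulse `c` to `v`; here `g (pair 0 w)` is the code of the configuration at `w`. -/
def PulseIn (M : GraphMachine) (g : ℕ → ℕ) (v c w : ℕ) : Prop :=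
  w ∈ M.graph.G ∧ c ∈ fs (Encodable.encode (M.graph.E w v)) ∧ c ∈ fs (g (Nat.pair 0 w)).unpair.1

/-- The result of the lookup table. -/
def Tn (M : GraphMachine) (v X u : ℕ) : ℕ :=
  Encodable.encode (M.T (M.graph.V v) (fs X) u.unpair.2.unpair.1 u.unpair.2.unpair.2)

/-- The colors allowed at `v` satisfying `Q`. -/
def filt (M : GraphMachine) (v : ℕ) (Q : ℕ → Prop) : Finset ℕ :=
  (M.graph.gam (M.graph.V v)).filter Q

/-- Witness predicate for failure of the approximation property. -/
def BadW (M : GraphMachine) (g : ℕ → ℕ) (b v b' X X' : ℕ) : Prop :=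
  v ∈ fs b ∧ fs b ⊆ fs b' ∧ (∀ w ∈ fs b', w ∈ M.graph.G) ∧
    fs X = filt M v (fun c => ∃ w ∈ fs b, PulseIn M g v c w) ∧
    fs X' = filt M v (fun c => ∃ w ∈ fs b', PulseIn M g v c w) ∧
    ¬ Tn M v X (g (Nat.pair 0 v)) = Tn M v X' (g (Nat.pair 0 v))

/-- Failure of the approximation property. -/
def Bad (M : GraphMachine) (g : ℕ → ℕ) (b : ℕ) : Prop :=
  ∃ y : ℕ, BadW M g b y.unpair.1 y.unpair.2.unpair.1 y.unpair.2.unpair.2.unpair.1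
    y.unpair.2.unpair.2.unpair.2

/-- One step on codes. -/
def fnext (M : GraphMachine) (g : ℕ → ℕ) (v : ℕ) : ℕ :=
  Tn M v (Encodable.encode (filt M v (fun c => ∃ w, PulseIn M g v c w))) (g (Nat.pair 0 v))

/-- The step operator. -/
def Step (M : GraphMachine) (g : ℕ → ℕ) (x : ℕ) : ℕ :=
  if x.unpair.1 = 0 then fnext M g x.unpair.2
  else if x.unpair.1 = 1 then
    if x.unpair.2.unpair.1 < g (Nat.pair 2 0) then g x
    else if x.unpair.2.unpair.1 = g (Nat.pair 2 0) then
      if ¬ Bad M g x.unpair.2.unpair.2 then 1 else 0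
    else 0
  else g (Nat.pair 2 0) + 1

theorem OCP.inG {M : GraphMachine} (hM : M.Computable') {F : K → α → ℕ} (hF : OC D e F) : OCP D e (fun k a => F k a ∈ M.graph.G) :=
  OCP.comp (OCP.of_computable hM.1.1) hF

theorem OCP.pulseIn {M : GraphMachine} (hM : M.Computable') {γ : K → ℕ → ℕ} (hγ : OC D e γ) {v c w : K → α → ℕ} (hv : OC D e v)
    (hc : OC D e c) (hw : OC D e w) :
    OCP D e (fun k a => PulseIn M (γ k) (v k a) (c k a) (w k a)) := by
  refine (OCP.inG hM hw).and ((OCP.mem hc ?_).and (OCP.mem hc ?_))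
  · exact OC.cc (f := fun p : ℕ × ℕ => Encodable.encode (M.graph.E p.1 p.2)) hM.1.2.2.2.2.1 (hw.pair hv)
  · exact (hγ.comp (OC.np (OC.const 0) hw)).u1

theorem OC.tn {M : GraphMachine} (hM : M.Computable') {v X u : K → α → ℕ} (hv : OC D e v) (hX : OC D e X) (hu : OC D e u) :
    OC D e (fun k a => Tn M (v k a) (X k a) (u k a)) := by
  have hV : OC D e (fun k a => M.graph.V (v k a)) := OC.cc hM.1.2.2.2.1 hv
  exact OC.cc (f := fun q : ℕ × ℕ × ℕ × ℕ =>
      Encodable.encode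
        (M.T q.1 ((Encodable.decode (α := Finset ℕ) q.2.1).getD ∅) q.2.2.1 q.2.2.2)) hM.2.2.2 (hV.pair (hX.pair (hu.u2.u1.pair hu.u2.u2)))

theorem OCP.filt {M : GraphMachine} (hM : M.Computable') {v X : K → α → ℕ} (hv : OC D e v) (hX : OC D e X) {Q : K → α × ℕ → Prop}
    (hQ : OCP D e Q) :
    OCP D e (fun k a => fs (X k a) = GTM.filt M (v k a) (fun c => Q k (a, c))) := by
  have hg : OC D e (fun k a => Encodable.encode (M.graph.gam (M.graph.V (v k a)))) :=
    OC.cc (f := fun v => Encodable.encode (M.graph.gam (M.graph.V v))) (hM.1.2.2.2.2.2.comp hM.1.2.2.2.1) hv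
  have h1 := OCP.forall_fs hX
    (P := fun k p => p.2 ∈ fs (Encodable.encode (M.graph.gam (M.graph.V (v k p.1)))) ∧ Q k p)
    ((OCP.mem OC.v2 hg.v1).and hQ)
  have h2 := OCP.forall_fs hg (P := fun k p => Q k p → p.2 ∈ fs (X k p.1))
    (hQ.imp (OCP.mem OC.v2 hX.v1))
  refine (h1.and h2).of_eq fun k a => ?_
  simp only [fs_encode, GTM.filt]
  constructor
  · rintro ⟨h, h'⟩
    ext c
    rw [Finset.mem_filter]
    exact ⟨h c, fun hc => h' c hc.1 hc.2⟩
  · intro h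
    rw [h]
    simp only [Finset.mem_filter]
    tauto

theorem OCPG.badW {M : GraphMachine} (hM : M.Computable') {b v b' X X' : (ℕ → ℕ) → α → ℕ} (hb : OCG b) (hv : OCG v) (hb' : OCG b')
    (hX : OCG X) (hX' : OCG X') :
    OCPG (fun g a => BadW M g (b g a) (v g a) (b' g a) (X g a) (X' g a)) := by
  have hγ : OCG (fun g x => g x) := OC.oracle OC.id
  have hp : OCPG (fun g (p : (α × ℕ) × ℕ) => PulseIn M g (v g p.1.1) p.1.2 p.2) :=
    OCP.pulseIn hM hγ hv.v1.v1 OC.v2.v1 OC.v2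
  have hq : OCG (fun g a => g (Nat.pair 0 (v g a))) := OC.oracle (OC.np (OC.const 0) hv)
  refine (OCP.mem hv hb).and ((OCP.subset hb hb').and (OCP.and ?_ (OCP.and ?_ (OCP.and ?_
    (OCP.eq (OC.tn hM hv hX hq) (OC.tn hM hv hX' hq)).not))))
  · exact OCP.forall_fs (P := fun k p => p.2 ∈ M.graph.G) hb' (OCP.inG hM OC.v2)
  · exact OCP.filt hM hv hX (OCP.exists_fs hb.v1 hp)
  · exact OCP.filt hM hv hX' (OCP.exists_fs hb'.v1 hp)

theorem OCPJ.bad {M : GraphMachine} (hM : M.Computable') : OCPJ (fun k b => Bad M k.g b) := by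
  have h2 : OCG (fun _ (p : ℕ × ℕ) => p.2) := OC.v2
  exact OCPJ.query (OCPG.badW hM (OC.of_computable Computable.fst) h2.u1 h2.u2.u1
    h2.u2.u2.u1 h2.u2.u2.u2)

theorem OCJ.fnext {M : GraphMachine} (hM : M.Computable') : OCJ (fun k v => GTM.fnext M k.g v) := by
  have hγ : OCG (fun g x => g x) := OC.oracle OC.id
  have h1 : OCPG (fun g (p : (ℕ × ℕ) × ℕ) => PulseIn M g p.1.1 p.1.2 p.2) :=
    OCP.pulseIn hM hγ (OC.of_computable (Computable.fst.comp Computable.fst))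
      (OC.of_computable (Computable.snd.comp Computable.fst)) OC.v2
  have h2 : OCPJ (fun k (p : ℕ × ℕ) => ∃ w, PulseIn M k.g p.1 p.2 w) := OCPJ.query h1
  have hv : OCJ (fun _ (p : ℕ × ℕ) => p.1) := OC.of_computable Computable.fst
  have h3 : OCPJ (fun k (p : ℕ × ℕ) =>
      fs p.2 = GTM.filt M p.1 (fun c => ∃ w, PulseIn M k.g p.1 c w)) :=
    OCP.filt hM hv OC.v2 (Q := fun k p => ∃ w, PulseIn M k.g p.1.1 p.2 w)
      (h2.comp ((OC.of_computable (Computable.fst.comp Computable.fst)).pair OC.v2))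
  refine OC.search h3 (fun k v => ⟨Encodable.encode (GTM.filt M v (fun c => ∃ w, PulseIn M k.g v c w)), fs_encode _⟩)
    (W := fun k p => Tn M p.1 p.2 (k.g (Nat.pair 0 p.1)))
    (OC.tn hM hv OC.v2 (OCJ.value.comp (OC.np (OC.const 0) hv))) fun k v X hX _ => ?_
  simp only at hX
  simp only [GTM.fnext, Tn, fs_encode, hX]

theorem OCJ.step {M : GraphMachine} (hM : M.Computable') : OCJ (fun k x => Step M k.g x) := by
  have hx : OCJ (fun _ (x : ℕ) => x) := OC.id
  have hn : OCJ (fun k (_ : ℕ) => k.g (Nat.pair 2 0)) := OCJ.value.comp (OC.const _)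
  have hb : OCJ (fun k (x : ℕ) => if ¬ Bad M k.g x.unpair.2.unpair.2 then 1 else 0) :=
    OC.of_eq ((OCPJ.bad hM).not.comp hx.u2.u2 :) (fun k x => by congr)
  exact OC.ite (OCP.eq hx.u1 (OC.const 0)) ((OCJ.fnext hM).comp hx.u2)
    (OC.ite (OCP.eq hx.u1 (OC.const 1))
      (OC.ite (OCP.lt hx.u2.u1 hn) OCJ.value
        (OC.ite (OCP.eq hx.u2.u1 hn) hb (OC.const 0)))
      (OC.cc Primrec.succ.to_comp hn))



/-! ### Semantics -/

/-- The approximation property for a single finite set. -/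
def Good (M : GraphMachine) (h : Config) (B : Set ℕ) : Prop :=
  ∀ B' : Set ℕ, B ⊆ B' → B' ⊆ M.graph.G → ∀ v ∈ B,
    (M.restrict B).run (restrictConfig M h B) 1 v =
      (M.restrict B').run (restrictConfig M h B') 1 v

theorem run_restrict (M : GraphMachine) (h : Config) (B : Set ℕ) {v : ℕ} (hv : v ∈ B) :
    (M.restrict B).run (restrictConfig M h B) 1 v =
      M.T (M.graph.V v) (filt M v (fun c => ∃ w ∈ B, w ∈ M.graph.G ∧ c ∈ M.graph.E w v ∧
        c ∈ (h w).1)) (h v).2.1 (h v).2.2 := by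
  simp only [GraphMachine.run, GraphMachine.step, GraphMachine.pulses, GraphMachine.restrict,
    ColoredGraph.restrict, restrictConfig, filt, if_pos hv]
  congr 1
  apply Finset.filter_congr
  intro c _
  constructor
  · rintro ⟨w, ⟨h1, h2⟩, h3, h4⟩
    rw [if_pos h2] at h4
    exact ⟨w, h2, h1, h3, h4⟩
  · rintro ⟨w, h2, h1, h3, h4⟩
    refine ⟨w, ⟨h1, h2⟩, h3, ?_⟩
    rwa [if_pos h2]

theorem encode_triple (x : Finset ℕ × ℕ × ℕ) :
    Encodable.encode x = Nat.pair (Encodable.encode x.1) (Nat.pair x.2.1 x.2.2) := by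
  rfl

section
variable {M : GraphMachine} {g : ℕ → ℕ} {h : Config}

theorem pulseIn_iff (hg : ∀ v, g (Nat.pair 0 v) = Encodable.encode (h v)) (v c w : ℕ) :
    PulseIn M g v c w ↔ w ∈ M.graph.G ∧ c ∈ M.graph.E w v ∧ c ∈ (h w).1 := by
  simp only [PulseIn, hg, encode_triple, Nat.unpair_pair, fs_encode]

theorem tn_eq (hg : ∀ v, g (Nat.pair 0 v) = Encodable.encode (h v)) (v X : ℕ) :
    Tn M v X (g (Nat.pair 0 v)) =
      Encodable.encode (M.T (M.graph.V v) (fs X) (h v).2.1 (h v).2.2) := by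
  simp only [Tn, hg]
  rw [encode_triple (h v)]
  simp only [Nat.unpair_pair]

theorem fnext_eq (hg : ∀ v, g (Nat.pair 0 v) = Encodable.encode (h v)) (v : ℕ) :
    fnext M g v = Encodable.encode (M.step h v) := by
  simp only [fnext, tn_eq hg, fs_encode, pulseIn_iff hg]
  rfl

theorem not_bad_iff (hg : ∀ v, g (Nat.pair 0 v) = Encodable.encode (h v)) (b : ℕ) :
    ¬ Bad M g b ↔ Good M h (fs b) := by
  constructor
  · intro hb B' hB hG v hv
    by_contra hne
    apply hb
    rw [run_restrict M h _ hv, run_restrict M h _ (hB hv)] at hne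
    set Q : ℕ → Prop := fun c => ∃ w ∈ B', w ∈ M.graph.G ∧ c ∈ M.graph.E w v ∧ c ∈ (h w).1
      with hQ
    have hex : ∀ c, ∃ w, Q c → w ∈ B' ∧ w ∈ M.graph.G ∧ c ∈ M.graph.E w v ∧ c ∈ (h w).1 := by
      intro c
      by_cases hc : Q c
      · obtain ⟨w, hw⟩ := hc
        exact ⟨w, fun _ => hw⟩
      · exact ⟨0, fun h => absurd h hc⟩
    choose W hW using hex
    set B'' : Finset ℕ := fs b ∪ (filt M v Q).image W with hB''
    have hsub : ∀ w ∈ B'', w ∈ B' := by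
      intro w hw
      rcases Finset.mem_union.1 hw with hw | hw
      · exact hB hw
      · obtain ⟨c, hc, rfl⟩ := Finset.mem_image.1 hw
        exact (hW c (Finset.mem_filter.1 hc).2).1
    have hfil : filt M v (fun c => ∃ w ∈ B'', w ∈ M.graph.G ∧ c ∈ M.graph.E w v ∧ c ∈ (h w).1)
        = filt M v Q := by
      ext c
      simp only [filt, Finset.mem_filter]
      refine and_congr_right fun hc => ⟨?_, ?_⟩
      · rintro ⟨w, hw, h'⟩
        exact ⟨w, hsub w hw, h'⟩
      · intro hq
        refine ⟨W c, ?_, (hW c hq).2⟩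
        exact Finset.mem_union_right _ (Finset.mem_image_of_mem _ (Finset.mem_filter.2 ⟨hc, hq⟩))
    refine ⟨Nat.pair v (Nat.pair (Encodable.encode B'') (Nat.pair
      (Encodable.encode (filt M v (fun c => ∃ w ∈ fs b, PulseIn M g v c w)))
      (Encodable.encode (filt M v Q)))), ?_⟩
    simp only [Nat.unpair_pair, BadW, fs_encode, tn_eq hg, pulseIn_iff hg, hfil]
    refine ⟨hv, Finset.subset_union_left, fun w hw => hG (hsub w hw), trivial, trivial, ?_⟩
    exact fun he => hne (Encodable.encode_injective he)
  · rintro hgood ⟨y, h1, h2, h3, h4, h5, h6⟩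
    apply h6
    have := hgood (fs y.unpair.2.unpair.1) (by exact_mod_cast h2) h3 _ h1
    rw [run_restrict M h _ h1, run_restrict M h _ (h2 h1)] at this
    rw [tn_eq hg, tn_eq hg, h4, h5]
    simp only [pulseIn_iff hg]
    exact congrArg _ this

end

/-- The sequence of functions computed from the iterated jumps. -/
def Hf (M : GraphMachine) (f : Config) (n x : ℕ) : ℕ :=
  if x.unpair.1 = 0 then Encodable.encode (M.run f n x.unpair.2)
  else if x.unpair.1 = 1 then
    if x.unpair.2.unpair.1 < n ∧ Good M (M.run f x.unpair.2.unpair.1) (fs x.unpair.2.unpair.2)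
      then 1 else 0
  else n

theorem Hf_zero (M : GraphMachine) (f : Config) (n v : ℕ) :
    Hf M f n (Nat.pair 0 v) = Encodable.encode (M.run f n v) := by
  simp [Hf]

theorem Hf_two (M : GraphMachine) (f : Config) (n v : ℕ) : Hf M f n (Nat.pair 2 v) = n := by
  simp [Hf]

theorem Hf_succ (M : GraphMachine) (f : Config) (n : ℕ) : Hf M f (n + 1) = Step M (Hf M f n) := by
  funext x
  rw [Step, fnext_eq (Hf_zero M f n), Hf_two, Hf]
  simp only [not_bad_iff (Hf_zero M f n)]
  by_cases h0 : x.unpair.1 = 0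
  · simp [h0, GraphMachine.run]
  by_cases h1 : x.unpair.1 = 1
  · simp only [h1, one_ne_zero, if_false, if_true]
    rcases lt_trichotomy x.unpair.2.unpair.1 n with h | h | h
    · rw [if_pos h]
      simp [Hf, h1, h, Nat.lt_succ_of_lt h]
    · simp [h]
    · rw [if_neg (by omega), if_neg (by omega), if_neg (by omega)]
  · simp [h0, h1]

theorem OC.Hf {M : GraphMachine} (hM : M.Computable') (f : Config) :
    OC (fun n => tjumpIter (configFn f) n) (fun n => n) (GTM.Hf M f) := by
  have h0 : OC (fun O : ℕ → ℕ => O) (fun _ => 0)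
      (fun O (x : ℕ) => if x.unpair.1 = 0 then O x.unpair.2 else 0) := by
    have hx : OC (fun O : ℕ → ℕ => O) (fun _ => 0) (fun _ (x : ℕ) => x) := OC.id
    exact OC.ite (OCP.eq hx.u1 (OC.const 0)) (OC.oracle hx.u2) (OC.const 0)
  obtain ⟨c, hc⟩ := h0
  have hc' : ∀ (O : ℕ → ℕ) (x : ℕ), (OCode.comp c (.pair .zero (.pair .left .right))).eval O x =
      Part.some (if x.unpair.1 = 0 then O x.unpair.2 else 0) := by
    intro O x
    have : (OCode.pair .zero (.pair .left .right)).eval O x = Part.some (Nat.pair 0 x) := by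
      rw [eval_pair (eval_zero O x) (eval_pair (eval_left O x) (eval_right O x)),
        Nat.pair_unpair]
    rw [eval_comp this]
    exact hc O x
  refine iterate (OCJ.step hM) (configFn f) (GTM.Hf M f) (Hf_succ M f) _
    (fun O' x => ⟨_, hc' O' x⟩) fun x => (hc' _ x).trans ?_
  congr 1
  simp [GTM.Hf, configFn, GraphMachine.run]

theorem approxChar_eq (M : GraphMachine) (f : Config) (n k : ℕ) :
    approxChar M f n k = if (Vld k.unpair.1 ∧ (∀ m ∈ lst k.unpair.2, Vld m) ∧
      (lst k.unpair.2).length = n + 1 ∧ (∀ w ∈ fs k.unpair.1, w ∈ M.graph.G) ∧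
      (fs ((lst k.unpair.2).getD 0 0) ⊆ fs k.unpair.1 ∧
        fs k.unpair.1 ⊆ fs ((lst k.unpair.2).getD 0 0)) ∧
      (∀ i < n + 1, ∀ w ∈ fs ((lst k.unpair.2).getD i 0), w ∈ M.graph.G) ∧
      (∀ i < n, fs ((lst k.unpair.2).getD i 0) ⊆ fs ((lst k.unpair.2).getD (i + 1) 0)) ∧
      (∀ i < n, Hf M f n (Nat.pair 1 (Nat.pair i ((lst k.unpair.2).getD (i + 1) 0))) = 1))
      then 1 else 0 := by
  have hd : Encodable.decode (α := Finset ℕ × List (Finset ℕ)) k =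
      if Vld k.unpair.1 ∧ ∀ m ∈ lst k.unpair.2, Vld m then
        some (fs k.unpair.1, (lst k.unpair.2).map fs) else none := by
    rw [Encodable.decode_prod_val, decode_eq, decode_list]
    by_cases ha : Vld k.unpair.1 <;> by_cases hb : ∀ m ∈ lst k.unpair.2, Vld m <;>
        simp [ha, hb]
  rw [approxChar, hd]
  by_cases hv : Vld k.unpair.1 ∧ ∀ m ∈ lst k.unpair.2, Vld m
  · rw [if_pos hv]
    simp only [getD_fs, List.length_map]
    congr 1
    rw [eq_iff_iff]
    refine ⟨?_, ?_⟩
    · rintro ⟨h1, h2, h3, h4, h5, h6⟩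
      refine ⟨hv.1, hv.2, h1, fun w hw => h2 hw, ?_, fun i hi w hw => h4 i (by omega) hw,
        fun i hi => by exact_mod_cast h5 i hi, fun i hi => ?_⟩
      · have := Finset.coe_injective h3
        exact ⟨this.subset, this.symm.subset⟩
      · have : Good M (M.run f i) (fs ((lst k.unpair.2).getD (i + 1) 0)) := h6 i hi
        simp [Hf, hi, this, -List.getD_eq_getElem?_getD]
    · rintro ⟨-, -, h1, h2, h3, h4, h5, h6⟩
      refine ⟨h1, fun w hw => h2 w hw, ?_, fun i hi w hw => h4 i (by omega) w hw,
        fun i hi => by exact_mod_cast h5 i hi, fun i hi => ?_⟩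
      · exact congrArg _ (Finset.Subset.antisymm h3.1 h3.2)
      · have := h6 i hi
        simp only [Hf, Nat.unpair_pair, one_ne_zero, if_false, if_true] at this
        by_contra hc
        rw [if_neg (fun h => hc h.2)] at this
        exact zero_ne_one this
  · rw [if_neg hv, if_neg]
    exact fun h => hv ⟨h.1, h.2.1⟩

theorem OC.approx {M : GraphMachine} (hM : M.Computable') (f : Config) :
    OC (fun n => tjumpIter (configFn f) n) (fun n => n) (approxChar M f) := by
  have hH := OC.Hf hM f
  have hx : OC (fun n => tjumpIter (configFn f) n) (fun n => n) (fun _ (x : ℕ) => x) := OC.id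
  have hn {α : Type} [Primcodable α] : OC (fun n => tjumpIter (configFn f) n) (fun n => n)
    (fun n (_ : α) => n) := OC.param
  have hl : OC (fun n => tjumpIter (configFn f) n) (fun n => n)
      (fun _ (x : ℕ) => lst x.unpair.2) := OC.cc lst_computable hx.u2
  have hget {α : Type} [Primcodable α] {F : ℕ → α → List ℕ} {i : ℕ → α → ℕ}
      (hF : OC (fun n => tjumpIter (configFn f) n) (fun n => n) F)
      (hi : OC (fun n => tjumpIter (configFn f) n) (fun n => n) i) :
      OC (fun n => tjumpIter (configFn f) n) (fun n => n) (fun k a => (F k a).getD (i k a) 0) :=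
    OC.cc₂ (f := fun (l : List ℕ) n => l.getD n 0) (Primrec.list_getD 0).to_comp hF hi
  have hi : OC (fun n => tjumpIter (configFn f) n) (fun n => n) (fun _ (p : ℕ × ℕ) => p.2) := OC.v2
  have hi' : OC (fun n => tjumpIter (configFn f) n) (fun n => n)
    (fun _ (p : ℕ × ℕ) => p.2 + 1) := OC.cc Primrec.succ.to_comp hi
  have hs : OC (fun n => tjumpIter (configFn f) n) (fun n => n)
    (fun n (_ : ℕ) => n + 1) := OC.cc Primrec.succ.to_comp hn
  have key := (OCP.vld hx.u1).and ((OCP.forall_lst (P := fun _ p => Vld p.2) hx.u2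
    (OCP.vld OC.v2)).and ((OCP.eq (OC.cc Computable.list_length hl) hs).and
    ((OCP.forall_fs (P := fun _ p => p.2 ∈ M.graph.G) hx.u1 (OCP.inG hM OC.v2)).and
    (((OCP.subset (hget hl (OC.const 0)) hx.u1).and
      (OCP.subset hx.u1 (hget hl (OC.const 0)))).and
    ((OCP.ball hs (OCP.forall_fs (P := fun _ p => p.2 ∈ M.graph.G) (hget hl.v1 hi)
      (OCP.inG hM OC.v2))).and
    ((OCP.ball hn (OCP.subset (hget hl.v1 hi) (hget hl.v1 hi'))).and
    (OCP.ball hn (OCP.eq (hH.comp (OC.np (OC.const 1) (OC.np hi (hget hl.v1 hi'))))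
      (OC.const 1)))))))))
  exact OC.of_eq key fun n k => by
    rw [approxChar_eq]
    congr

/-- Hardwire the parameter into a code. -/
theorem hardwire {O F : ℕ → ℕ} (c : OCode) (n : ℕ)
    (hc : ∀ x, c.eval O (Nat.pair n x) = Part.some (F x)) : TuringLE F O := by
  refine ⟨.comp c (.pair (OCode.ofNat (constIdx n)) (.pair .left .right)), fun x => ?_⟩
  have : (OCode.pair (OCode.ofNat (constIdx n)) (.pair .left .right)).eval O x =
      Part.some (Nat.pair n x) := by
    rw [eval_pair (eval_constIdx O n x) (eval_pair (eval_left O x) (eval_right O x)),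
      Nat.pair_unpair]
  rw [eval_comp this]
  exact hc x

end GTM

/-- For every computable graph machine `M` and valid configuration
`f` (serving, via `configFn f`, as a Turing oracle of degree `𝐟`): the collection
`P_n(f)` of `n`-approximations and the configuration `f_n = ⟨M,f⟩(·,n)` are both
`𝐟^(n)`-computable, moreover uniformly in `n` (a single oracle code works for all
`n`, relative to the oracle `𝐟^(n)`). -/
theorem stmt4 (M : GraphMachine) (hM : M.Computable') (f : Config) (hf : M.Valid f) :
    (∀ n : ℕ, TuringLE (approxChar M f n) (tjumpIter (configFn f) n)) ∧
    (∀ n : ℕ,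
      TuringLE (fun v => if v ∈ M.graph.G then Encodable.encode (M.run f n v) else 0)
        (tjumpIter (configFn f) n)) ∧
    (∃ c : OCode, ∀ n k : ℕ,
        c.eval (tjumpIter (configFn f) n) (Nat.pair n k) =
          Part.some (approxChar M f n k)) ∧
    (∃ c : OCode, ∀ n : ℕ, ∀ v ∈ M.graph.G,
        c.eval (tjumpIter (configFn f) n) (Nat.pair n v) =
          Part.some (Encodable.encode (M.run f n v))) := by
  have hR : GTM.OC (fun n => tjumpIter (configFn f) n) (fun n => n)
      (fun n v => Encodable.encode (M.run f n v)) :=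
    ((GTM.OC.Hf hM f).comp (GTM.OC.np (GTM.OC.const 0) GTM.OC.id)).of_eq
      fun n v => GTM.Hf_zero M f n v
  have hR' : GTM.OC (fun n => tjumpIter (configFn f) n) (fun n => n)
      (fun n v => if v ∈ M.graph.G then Encodable.encode (M.run f n v) else 0) :=
    GTM.OC.ite (GTM.OCP.inG hM GTM.OC.id) hR (GTM.OC.const 0)
  obtain ⟨c₁, h₁⟩ := GTM.OC.approx hM f
  obtain ⟨c₂, h₂⟩ := hR
  obtain ⟨c₃, h₃⟩ := hR'
  exact ⟨fun n => GTM.hardwire c₁ n fun x => h₁ n x, fun n => GTM.hardwire c₃ n fun x => h₃ n x,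
    ⟨c₁, fun n k => h₁ n k⟩, ⟨c₂, fun n v _ => h₂ n v⟩⟩

end
end

section
/- Let 𝔐 be a computable graph machine and let f be a valid configuration of 𝔐 of Turing degree 𝐟. Then for each n ∈ ℕ the function f_n := ⟨𝔐,f⟩(·,n) is 𝐟^(n)-computable, uniformly in n, and consequently the run ⟨𝔐,f⟩ is 𝐟^(ω)-computable. -/
open scoped Classical
noncomputable section

/-! ### Helper lemmas -/

namespace OCode

theorem eval_zero' (O : ℕ → ℕ) (n : ℕ) : OCode.zero.eval O n = Part.some 0 := rfl
theorem eval_succ' (O : ℕ → ℕ) (n : ℕ) : OCode.succ.eval O n = Part.some (n + 1) := rfl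
theorem eval_left' (O : ℕ → ℕ) (n : ℕ) : OCode.left.eval O n = Part.some n.unpair.1 := rfl
theorem eval_right' (O : ℕ → ℕ) (n : ℕ) : OCode.right.eval O n = Part.some n.unpair.2 := rfl
theorem eval_oracle' (O : ℕ → ℕ) (n : ℕ) : OCode.oracle.eval O n = Part.some (O n) := rfl

theorem eval_pair' (O : ℕ → ℕ) (a b : OCode) (n : ℕ) :
    (OCode.pair a b).eval O n = Nat.pair <$> a.eval O n <*> b.eval O n := rfl

theorem eval_comp' (O : ℕ → ℕ) (a b : OCode) (n : ℕ) :
    (OCode.comp a b).eval O n = (b.eval O n).bind (a.eval O) := rfl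

theorem eval_rfind' (O : ℕ → ℕ) (a : OCode) (x m : ℕ) :
    (OCode.rfind' a).eval O (Nat.pair x m) =
      (Nat.rfind fun n => (fun y => decide (y = 0)) <$> a.eval O (Nat.pair x (n + m))).map
        (· + m) := by
  simp [OCode.eval]

theorem eval_prec_zero (O : ℕ → ℕ) (a b : OCode) (x : ℕ) :
    (OCode.prec a b).eval O (Nat.pair x 0) = a.eval O x := by
  simp [OCode.eval]

theorem eval_prec_succ (O : ℕ → ℕ) (a b : OCode) (x m : ℕ) :
    (OCode.prec a b).eval O (Nat.pair x (m + 1)) =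
      ((OCode.prec a b).eval O (Nat.pair x m)).bind
        (fun i => b.eval O (Nat.pair x (Nat.pair m i))) := by
  simp [OCode.eval]

theorem eval_pair_some {O : ℕ → ℕ} {a b : OCode} {n x y : ℕ}
    (ha : a.eval O n = Part.some x) (hb : b.eval O n = Part.some y) :
    (OCode.pair a b).eval O n = Part.some (Nat.pair x y) := by
  rw [eval_pair', ha, hb]; simp [Seq.seq]

theorem eval_comp_some {O : ℕ → ℕ} {a b : OCode} {n x : ℕ}
    (hb : b.eval O n = Part.some x) :
    (OCode.comp a b).eval O n = a.eval O x := by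
  rw [eval_comp', hb]; exact Part.bind_some _ _

/-- identity code -/
def idc : OCode := .pair .left .right

theorem eval_idc (O : ℕ → ℕ) (n : ℕ) : idc.eval O n = Part.some n := by
  rw [idc, eval_pair_some (eval_left' O n) (eval_right' O n), Nat.pair_unpair]

/-- constant code -/
def constc : ℕ → OCode
  | 0 => .zero
  | n + 1 => .comp .succ (constc n)

theorem eval_constc (O : ℕ → ℕ) (k n : ℕ) : (constc k).eval O n = Part.some k := by
  induction k with
  | zero => rfl
  | succ k ih => rw [constc, eval_comp_some ih, eval_succ']

/-- Translation of ordinary codes. -/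
theorem exists_of_code (c : Nat.Partrec.Code) : ∃ d : OCode, ∀ O, d.eval O = c.eval := by
  induction c with
  | zero => exact ⟨.zero, fun O => rfl⟩
  | succ => exact ⟨.succ, fun O => rfl⟩
  | left => exact ⟨.left, fun O => rfl⟩
  | right => exact ⟨.right, fun O => rfl⟩
  | pair a b iha ihb =>
    obtain ⟨a', ha⟩ := iha
    obtain ⟨b', hb⟩ := ihb
    exact ⟨.pair a' b', fun O => by simp only [OCode.eval, Nat.Partrec.Code.eval, ha, hb]; rfl⟩
  | comp a b iha ihb =>
    obtain ⟨a', ha⟩ := iha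
    obtain ⟨b', hb⟩ := ihb
    exact ⟨.comp a' b', fun O => by simp only [OCode.eval, Nat.Partrec.Code.eval, ha, hb]; rfl⟩
  | prec a b iha ihb =>
    obtain ⟨a', ha⟩ := iha
    obtain ⟨b', hb⟩ := ihb
    exact ⟨.prec a' b', fun O => by simp only [OCode.eval, Nat.Partrec.Code.eval, ha, hb]; rfl⟩
  | rfind' a iha =>
    obtain ⟨a', ha⟩ := iha
    exact ⟨.rfind' a', fun O => by simp only [OCode.eval, Nat.Partrec.Code.eval, ha]; rfl⟩

theorem exists_of_computable {α σ : Type} [Primcodable α] [Primcodable σ] {f : α → σ}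
    (hf : Computable f) :
    ∃ c : OCode, ∀ O a, c.eval O (Encodable.encode a) = Part.some (Encodable.encode (f a)) := by
  obtain ⟨c, hc⟩ := Nat.Partrec.Code.exists_code.1 hf
  obtain ⟨d, hd⟩ := exists_of_code c
  refine ⟨d, fun O a => ?_⟩
  rw [hd, hc]
  simp

/-! numeric indices -/

def epair (a b : ℕ) : ℕ := 4 * Nat.pair a b + 5
def ecomp (a b : ℕ) : ℕ := 4 * Nat.pair a b + 6
def eprec (a b : ℕ) : ℕ := 4 * Nat.pair a b + 7
def erfind (a : ℕ) : ℕ := 4 * Nat.pair a 0 + 8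

theorem ofNat_zero : ofNat 0 = .zero := by rw [ofNat]
theorem ofNat_right : ofNat 3 = .right := by rw [ofNat]
theorem ofNat_oracle : ofNat 4 = .oracle := by rw [ofNat]

theorem ofNat_epair (a b : ℕ) : ofNat (epair a b) = .pair (ofNat a) (ofNat b) := by
  have h1 : (4 * Nat.pair a b) % 4 = 0 := by omega
  have h2 : (4 * Nat.pair a b) / 4 = Nat.pair a b := by omega
  rw [epair, ofNat]
  simp [h1, h2]

theorem ofNat_ecomp (a b : ℕ) : ofNat (ecomp a b) = .comp (ofNat a) (ofNat b) := by
  have h1 : (4 * Nat.pair a b + 1) % 4 = 1 := by omega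
  have h2 : (4 * Nat.pair a b + 1) / 4 = Nat.pair a b := by omega
  rw [ecomp, show 4 * Nat.pair a b + 6 = (4 * Nat.pair a b + 1) + 5 from rfl, ofNat]
  simp [h1, h2]

theorem ofNat_eprec (a b : ℕ) : ofNat (eprec a b) = .prec (ofNat a) (ofNat b) := by
  have h1 : (4 * Nat.pair a b + 2) % 4 = 2 := by omega
  have h2 : (4 * Nat.pair a b + 2) / 4 = Nat.pair a b := by omega
  rw [eprec, show 4 * Nat.pair a b + 7 = (4 * Nat.pair a b + 2) + 5 from rfl, ofNat]
  simp [h1, h2]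

theorem ofNat_erfind (a : ℕ) : ofNat (erfind a) = .rfind' (ofNat a) := by
  have h1 : (4 * Nat.pair a 0 + 3) % 4 = 3 := by omega
  have h2 : (4 * Nat.pair a 0 + 3) / 4 = Nat.pair a 0 := by omega
  rw [erfind, show 4 * Nat.pair a 0 + 8 = (4 * Nat.pair a 0 + 3) + 5 from rfl, ofNat]
  simp [h1, h2]

theorem ofNat_surj (c : OCode) : ∃ n, ofNat n = c := by
  induction c with
  | zero => exact ⟨0, by rw [ofNat]⟩
  | succ => exact ⟨1, by rw [ofNat]⟩
  | left => exact ⟨2, by rw [ofNat]⟩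
  | right => exact ⟨3, by rw [ofNat]⟩
  | oracle => exact ⟨4, by rw [ofNat]⟩
  | pair a b iha ihb =>
    obtain ⟨a, rfl⟩ := iha; obtain ⟨b, rfl⟩ := ihb; exact ⟨_, ofNat_epair a b⟩
  | comp a b iha ihb =>
    obtain ⟨a, rfl⟩ := iha; obtain ⟨b, rfl⟩ := ihb; exact ⟨_, ofNat_ecomp a b⟩
  | prec a b iha ihb =>
    obtain ⟨a, rfl⟩ := iha; obtain ⟨b, rfl⟩ := ihb; exact ⟨_, ofNat_eprec a b⟩
  | rfind' a iha =>
    obtain ⟨a, rfl⟩ := iha; exact ⟨_, ofNat_erfind a⟩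

/-- index of a constant code -/
def econst : ℕ → ℕ := fun n => Nat.rec 0 (fun _ ih => ecomp 1 ih) n

theorem ofNat_econst (k : ℕ) : ofNat (econst k) = constc k := by
  induction k with
  | zero => exact ofNat_zero
  | succ k ih =>
    change ofNat (ecomp 1 (econst k)) = _
    rw [ofNat_ecomp, ih, constc]
    congr 1
    rw [ofNat]

theorem primrec_epair : Primrec₂ epair :=
  Primrec.nat_add.comp (Primrec.nat_mul.comp (Primrec.const 4) Primrec₂.natPair) (Primrec.const 5)
theorem primrec_ecomp : Primrec₂ ecomp :=
  Primrec.nat_add.comp (Primrec.nat_mul.comp (Primrec.const 4) Primrec₂.natPair) (Primrec.const 6)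
theorem primrec_erfind : Primrec erfind :=
  Primrec.nat_add.comp (Primrec.nat_mul.comp (Primrec.const 4)
    (Primrec₂.natPair.comp Primrec.id (Primrec.const 0))) (Primrec.const 8)
theorem primrec_econst : Primrec econst :=
  Primrec.nat_rec₁ 0 (primrec_ecomp.comp (Primrec.const 1) Primrec.snd).to₂

/-- The index for the query `∃ w, h (p, w, φ_e(w)) = 0`. -/
def query (k e p : ℕ) : ℕ :=
  ecomp (erfind (ecomp k (epair (econst p) (epair 3 (ecomp e 3))))) 0

theorem primrec_query (k : ℕ) : Primrec₂ (query k) := by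
  unfold query
  refine primrec_ecomp.comp (primrec_erfind.comp (primrec_ecomp.comp (Primrec.const k)
    (primrec_epair.comp (primrec_econst.comp Primrec.snd)
      (primrec_epair.comp (Primrec.const 3) (primrec_ecomp.comp Primrec.fst (Primrec.const 3))))))
      (Primrec.const 0)

theorem query_spec {k : ℕ} {h : ℕ × ℕ × ℕ → ℕ}
    (hk : ∀ O a, (ofNat k).eval O (Encodable.encode a) = Part.some (h a))
    {O : ℕ → ℕ} {e : ℕ} {g : ℕ → ℕ} (he : ∀ w, (ofNat e).eval O w = Part.some (g w)) (p : ℕ) :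
    tjump O (query k e p) = if ∃ w, h (p, w, g w) = 0 then 1 else 0 := by
  unfold tjump
  congr 1
  rw [query, ofNat_ecomp, ofNat_erfind, ofNat_ecomp, ofNat_epair, ofNat_epair, ofNat_econst,
    ofNat_ecomp, ofNat_right, ofNat_zero]
  rw [eval_comp_some (eval_zero' _ _)]
  have h0 := eval_rfind' O (OCode.comp (ofNat k) (OCode.pair (constc p)
      (OCode.pair OCode.right (OCode.comp (ofNat e) OCode.right)))) 0 0
  rw [show Nat.pair 0 0 = 0 from rfl] at h0
  rw [h0]
  have key : ∀ n, (OCode.comp (ofNat k) (OCode.pair (constc p)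
      (OCode.pair OCode.right (OCode.comp (ofNat e) OCode.right)))).eval O (Nat.pair 0 (n + 0))
      = Part.some (h (p, n, g n)) := by
    intro n
    have hr : OCode.right.eval O (Nat.pair 0 (n + 0)) = Part.some n := by
      rw [eval_right']; simp
    rw [eval_comp_some (eval_pair_some (eval_constc O p _) (eval_pair_some hr
      ((eval_comp_some hr).trans (he n))))]
    exact hk O (p, n, g n)
  rw [eq_iff_iff]
  constructor
  · intro hd
    obtain ⟨w, hw⟩ := Part.dom_iff_mem.1 (show (Nat.rfind _).Dom from hd)
    have := Nat.rfind_spec hw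
    rw [key] at this
    exact ⟨w, by simpa using this⟩
  · rintro ⟨w, hw⟩
    refine Nat.rfind_dom.2 ⟨w, ?_, ?_⟩
    · rw [key]; simp [hw]
    · intro m _
      rw [key]; trivial

theorem exists_search {c : OCode} {F : (ℕ → ℕ) → ℕ → ℕ}
    (hc : ∀ O n, c.eval O n = Part.some (F O n)) :
    ∃ c' : OCode, ∀ O a y, (∀ y', F O (Nat.pair a y') = 0 ↔ y' = y) →
      c'.eval O a = Part.some y := by
  refine ⟨.comp (.rfind' c) (.pair idc .zero), fun O a y hy => ?_⟩
  rw [eval_comp_some (eval_pair_some (eval_idc O a) (eval_zero' O a)), eval_rfind']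
  have : y ∈ (Nat.rfind fun n =>
      (fun y => decide (y = 0)) <$> c.eval O (Nat.pair a (n + 0))) := by
    refine Nat.mem_rfind.2 ⟨?_, ?_⟩
    · rw [hc]
      simp [hy]
    · intro m hm
      rw [hc]
      simp [hy]
      omega
  rw [Part.eq_some_iff.2 this]
  simp

/-- Relativization to slices of an oracle. -/
theorem exists_slice (c : OCode) : ∃ c' : OCode, ∀ O n x,
    c'.eval O (Nat.pair n x) = c.eval (fun y => O (Nat.pair n y)) x := by
  have hre : Computable (fun q : (ℕ × ℕ) × ℕ => Nat.pair q.1.1 (Nat.pair q.1.2 q.2)) :=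
    (Primrec₂.natPair.comp (Primrec.fst.comp Primrec.fst)
      (Primrec₂.natPair.comp (Primrec.snd.comp Primrec.fst) Primrec.snd)).to_comp
  have hre2 : Computable (fun q : ℕ × ℕ × ℕ => Nat.pair (Nat.pair q.1 q.2.1) q.2.2) :=
    (Primrec₂.natPair.comp
      (Primrec₂.natPair.comp Primrec.fst (Primrec.fst.comp Primrec.snd))
      (Primrec.snd.comp Primrec.snd)).to_comp
  obtain ⟨r, hr'⟩ := exists_of_computable hre
  obtain ⟨s, hs'⟩ := exists_of_computable hre2
  have hr : ∀ O a b c, r.eval O (Nat.pair (Nat.pair a b) c) =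
      Part.some (Nat.pair a (Nat.pair b c)) := fun O a b c => hr' O ((a, b), c)
  have hs : ∀ O a b c, s.eval O (Nat.pair a (Nat.pair b c)) =
      Part.some (Nat.pair (Nat.pair a b) c) := fun O a b c => hs' O (a, b, c)
  have hR : ∀ O n x, OCode.right.eval O (Nat.pair n x) = Part.some x := fun O n x => by
    rw [eval_right']; simp
  have hL : ∀ O n x, OCode.left.eval O (Nat.pair n x) = Part.some n := fun O n x => by
    rw [eval_left']; simp
  induction c with
  | zero => exact ⟨.zero, fun O n x => rfl⟩
  | succ => exact ⟨.comp .succ .right, fun O n x => by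
      rw [eval_comp_some (hR O n x)]; rfl⟩
  | left => exact ⟨.comp .left .right, fun O n x => by
      rw [eval_comp_some (hR O n x)]; rfl⟩
  | right => exact ⟨.comp .right .right, fun O n x => by
      rw [eval_comp_some (hR O n x)]; rfl⟩
  | oracle => exact ⟨.oracle, fun O n x => rfl⟩
  | pair a b iha ihb =>
    obtain ⟨a', ha⟩ := iha; obtain ⟨b', hb⟩ := ihb
    exact ⟨.pair a' b', fun O n x => by rw [eval_pair', eval_pair', ha, hb]⟩
  | comp a b iha ihb =>
    obtain ⟨a', ha⟩ := iha; obtain ⟨b', hb⟩ := ihb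
    refine ⟨.comp a' (.pair .left b'), fun O n x => ?_⟩
    rw [eval_comp', eval_comp', eval_pair', hL, hb]
    simp only [Part.map_eq_map, Part.map_some, Seq.seq, Part.bind_some]
    refine (Part.bind_map _ _ _).trans ?_
    congr 1
    funext y
    exact ha O n y
  | prec a b iha ihb =>
    obtain ⟨a', ha⟩ := iha; obtain ⟨b', hb⟩ := ihb
    refine ⟨.comp (.prec a' (.comp b' r)) s, fun O n x => ?_⟩
    obtain ⟨x, m, rfl⟩ : ∃ u v, x = Nat.pair u v := ⟨_, _, (Nat.pair_unpair x).symm⟩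
    rw [eval_comp_some (hs O n x m)]
    induction m with
    | zero => rw [eval_prec_zero, eval_prec_zero, ha]
    | succ m ih =>
      rw [eval_prec_succ, eval_prec_succ, ih]
      congr 1
      funext i
      rw [eval_comp_some (hr O n x _), hb]
  | rfind' a iha =>
    obtain ⟨a', ha⟩ := iha
    refine ⟨.comp (.rfind' (.comp a' r)) s, fun O n x => ?_⟩
    obtain ⟨x, m, rfl⟩ : ∃ u v, x = Nat.pair u v := ⟨_, _, (Nat.pair_unpair x).symm⟩
    rw [eval_comp_some (hs O n x m), eval_rfind', eval_rfind']
    congr 2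
    funext k
    rw [eval_comp_some (hr O n x _), ha]

end OCode

/-! ### Codes of finite sets -/

/-- The list coded by a natural number. -/
def lst (k : ℕ) : List ℕ := Denumerable.ofNat (List ℕ) k

theorem encode_lst (k : ℕ) : Encodable.encode (lst k) = k := Denumerable.encode_ofNat k

theorem lst_encode (l : List ℕ) : lst (Encodable.encode l) = l := Denumerable.ofNat_encode l

theorem primrec_lst : Primrec lst := Primrec.ofNat (List ℕ)

theorem decode_finset_eq (l : List ℕ) :
    Encodable.decode (α := Finset ℕ) (Encodable.encode l) =
      if h : l.Nodup then some ⟨(l : Multiset ℕ), Multiset.coe_nodup.2 h⟩ else none := by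
  have h1 : Encodable.decode (α := Multiset ℕ) (Encodable.encode l) = some (l : Multiset ℕ) := by
    change decodeMultiset (Encodable.encode l) = _
    simp [decodeMultiset]
  change Option.bind (Option.bind (Encodable.decode (α := Multiset ℕ) (Encodable.encode l))
    (fun a => @dite (Option {s : Multiset ℕ // s.Nodup}) (Multiset.Nodup a)
      (@Multiset.nodupDecidable ℕ (Encodable.decidableEqOfEncodable ℕ) a)
      (fun h => some ⟨a, h⟩) (fun _ => none)))
    (fun x => some (⟨x.1, x.2⟩ : Finset ℕ)) = _
  rw [h1, Option.bind_some]
  by_cases h : l.Nodup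
  · rw [dif_pos (Multiset.coe_nodup.2 h), dif_pos h]
    rfl
  · rw [dif_neg (fun h' => h (Multiset.coe_nodup.1 h')), dif_neg h]
    rfl

theorem lst_spec (F : Finset ℕ) : (lst (Encodable.encode F)).Nodup ∧
    ∀ c, c ∈ lst (Encodable.encode F) ↔ c ∈ F := by
  have h := decode_finset_eq (lst (Encodable.encode F))
  rw [encode_lst, Encodable.encodek] at h
  by_cases hn : (lst (Encodable.encode F)).Nodup
  · rw [dif_pos hn] at h
    refine ⟨hn, fun c => ?_⟩
    have h' := congrArg Finset.val (Option.some.inj h)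
    rw [← Finset.mem_val, h']
    exact Multiset.mem_coe.symm
  · rw [dif_neg hn] at h
    cases h

theorem primrec_mem : PrimrecRel (fun (l : List ℕ) (c : ℕ) => c ∈ l) :=
  (PrimrecRel.exists_mem_list (R := fun a b : ℕ => a = b) Primrec.eq).of_eq (by simp)

/-! ### The main step -/

section Step

variable (M : GraphMachine)

/-- list of allowable colors at `v` -/
def gl (v : ℕ) : List ℕ := lst (Encodable.encode (M.graph.gam (M.graph.V v)))

theorem computable_gl (hM : M.Computable') : Computable (gl M) :=
  primrec_lst.to_comp.comp (hM.1.2.2.2.2.2.comp hM.1.2.2.2.1)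

/-- query body for values -/
def h1 (q : ℕ × ℕ × ℕ) : ℕ := if q.1 = Nat.pair q.2.1 q.2.2 then 0 else 1

theorem primrec_h1 : Primrec h1 :=
  Primrec.ite (Primrec.eq.comp Primrec.fst
    (Primrec₂.natPair.comp (Primrec.fst.comp Primrec.snd) (Primrec.snd.comp Primrec.snd)))
    (Primrec.const 0) (Primrec.const 1)

/-- query body for pulses -/
def h2 (q : ℕ × ℕ × ℕ) : ℕ :=
  bif decide (q.2.1 ∈ M.graph.G) &&
    (decide (q.1.unpair.2 ∈ lst (Encodable.encode (M.graph.E q.2.1 q.1.unpair.1))) &&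
    decide (q.1.unpair.2 ∈ lst q.2.2.unpair.1)) then 0 else 1

theorem computable_h2 (hM : M.Computable') : Computable (h2 M) := by
  obtain ⟨⟨hG, -, -, -, hE, -⟩, -⟩ := hM
  obtain ⟨_, hG⟩ := hG
  have hu : Computable Nat.unpair := Primrec.unpair.to_comp
  have hp1 : Computable (fun q : ℕ × ℕ × ℕ => q.1.unpair.1) :=
    Computable.fst.comp (hu.comp Computable.fst)
  have hp2 : Computable (fun q : ℕ × ℕ × ℕ => q.1.unpair.2) :=
    Computable.snd.comp (hu.comp Computable.fst)
  have hw : Computable (fun q : ℕ × ℕ × ℕ => q.2.1) := Computable.fst.comp Computable.snd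
  have hy : Computable (fun q : ℕ × ℕ × ℕ => q.2.2.unpair.1) :=
    Computable.fst.comp (hu.comp (Computable.snd.comp Computable.snd))
  have hmem : Computable₂ (fun (l : List ℕ) (c : ℕ) => decide (c ∈ l)) := by
    have := primrec_mem.decide.to_comp
    exact this.of_eq fun q => by simp
  have hand : Computable₂ and := Primrec.and.to_comp
  refine Computable.cond (hand.comp ?_ (hand.comp ?_ ?_)) (Computable.const 0) (Computable.const 1)
  · exact (hG.comp hw).of_eq fun q => by simp
  · exact hmem.comp (primrec_lst.to_comp.comp (hE.comp (hw.pair hp1))) hp2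
  · exact hmem.comp (primrec_lst.to_comp.comp hy) hp2

theorem h2_eq_zero (g : Config) (v c w : ℕ) :
    h2 M (Nat.pair v c, w, Encodable.encode (g w)) = 0 ↔
      w ∈ M.graph.G ∧ c ∈ M.graph.E w v ∧ c ∈ (g w).1 := by
  have : (Encodable.encode (g w)).unpair.1 = Encodable.encode (g w).1 := by
    rw [Encodable.encode_prod_val]; simp
  simp only [h2, this, Nat.unpair_pair, (lst_spec _).2]
  by_cases a : w ∈ M.graph.G <;> by_cases b : c ∈ M.graph.E w v <;>
    by_cases d : c ∈ (g w).1 <;> simp [a, b, d]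

/-- query index in the loop -/
def qq (k : ℕ) (q : (ℕ × ℕ) × ℕ × List ℕ) : ℕ :=
  OCode.query k q.1.1 (Nat.pair q.1.2 ((gl M q.1.2).getD q.2.1 0))

/-- update in the loop -/
def upd (q : ℕ × (ℕ × ℕ) × ℕ × List ℕ) : List ℕ :=
  if q.1 = 0 then q.2.2.2 else (gl M q.2.1.2).getD q.2.2.1 0 :: q.2.2.2

theorem computable_qq (hM : M.Computable') (k : ℕ) : Computable (qq M k) := by
  have hv : Computable (fun q : (ℕ × ℕ) × ℕ × List ℕ => q.1.2) :=
    Computable.snd.comp Computable.fst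
  exact (OCode.primrec_query k).to_comp.comp (Computable.fst.comp Computable.fst)
    (Primrec₂.natPair.to_comp.comp hv ((Primrec.list_getD 0).to_comp.comp
      ((computable_gl M hM).comp hv) (Computable.fst.comp Computable.snd)))

theorem computable_upd (hM : M.Computable') : Computable (upd M) := by
  have hv : Computable (fun q : ℕ × (ℕ × ℕ) × ℕ × List ℕ => q.2.1.2) :=
    Computable.snd.comp (Computable.fst.comp Computable.snd)
  have hacc : Computable (fun q : ℕ × (ℕ × ℕ) × ℕ × List ℕ => q.2.2.2) :=
    Computable.snd.comp (Computable.snd.comp Computable.snd)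
  have hb : Computable (fun q : ℕ × (ℕ × ℕ) × ℕ × List ℕ => decide (q.1 = 0)) :=
    (Primrec.eq (α := ℕ)).decide.to_comp.comp (Computable.fst) (Computable.const 0)
  refine (Computable.cond hb hacc (Computable.list_cons.comp
    ((Primrec.list_getD 0).to_comp.comp ((computable_gl M hM).comp hv)
      (Computable.fst.comp (Computable.snd.comp Computable.snd))) hacc)).of_eq fun q => ?_
  by_cases h : q.1 = 0 <;> simp [upd, h]

/-- The list of received colors, computed from the jump. -/
def recv (k : ℕ) (J : ℕ → ℕ) (e v n : ℕ) : List ℕ :=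
  (((gl M v).take n).filter (fun c => decide (J (OCode.query k e (Nat.pair v c)) ≠ 0))).reverse

theorem exists_loop (hM : M.Computable') (k : ℕ) : ∃ c : OCode, ∀ J e v,
    c.eval J (Nat.pair e v) =
      Part.some (Encodable.encode (recv M k J e v (gl M v).length)) := by
  obtain ⟨cq, hq⟩ := OCode.exists_of_computable (computable_qq M hM k)
  obtain ⟨cu, hu⟩ := OCode.exists_of_computable (computable_upd M hM)
  obtain ⟨cl, hl⟩ := OCode.exists_of_computable
    (f := fun q : ℕ × ℕ => Nat.pair (Nat.pair q.1 q.2) (gl M q.2).length)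
    (Primrec₂.natPair.to_comp.comp
      (Primrec₂.natPair.to_comp.comp Computable.fst Computable.snd)
      (Computable.list_length.comp ((computable_gl M hM).comp Computable.snd)))
  have hloop : ∀ J e v n, n ≤ (gl M v).length →
      (OCode.prec .zero (.comp cu (.pair (.comp .oracle cq) OCode.idc))).eval J
        (Nat.pair (Nat.pair e v) n) = Part.some (Encodable.encode (recv M k J e v n)) := by
    intro J e v n
    induction n with
    | zero =>
      intro _
      rw [OCode.eval_prec_zero, OCode.eval_zero']
      simp [recv]
    | succ n ih =>
      intro hn
      rw [OCode.eval_prec_succ, ih (by omega), Part.bind_some]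
      have hq' := hq J ((e, v), n, recv M k J e v n)
      have hu' := hu J (J (qq M k ((e, v), n, recv M k J e v n)), (e, v), n, recv M k J e v n)
      refine (OCode.eval_comp_some (OCode.eval_pair_some
        ((OCode.eval_comp_some hq').trans (OCode.eval_oracle' _ _)) (OCode.eval_idc _ _))).trans ?_
      refine hu'.trans ?_
      congr 2
      have hlt : n < (gl M v).length := by omega
      have hD : (gl M v).getD n 0 = (gl M v)[n] := List.getD_eq_getElem _ _ hlt
      have hR : recv M k J e v (n + 1) =
          if J (OCode.query k e (Nat.pair v (gl M v)[n])) = 0 then recv M k J e v n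
          else (gl M v)[n] :: recv M k J e v n := by
        simp only [recv]
        rw [List.take_add_one, List.filter_append, List.reverse_append,
          List.getElem?_eq_getElem hlt, Option.toList_some]
        by_cases h0 : J (OCode.query k e (Nat.pair v (gl M v)[n])) = 0
        · simp [h0]
        · simp [h0]
      rw [hR, ← hD]
      rfl
  refine ⟨.comp (OCode.prec .zero (.comp cu (.pair (.comp .oracle cq) OCode.idc))) cl,
    fun J e v => ?_⟩
  refine (OCode.eval_comp_some (hl J (e, v))).trans ?_
  exact hloop J e v _ le_rfl

/-- The final computable postprocessing. -/
def fin (q : (ℕ × ℕ) × ℕ × List ℕ) : ℕ :=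
  Encodable.encode (M.T (M.graph.V q.1.2)
    ((Encodable.decode (α := Finset ℕ) (Encodable.encode q.2.2)).getD ∅)
    q.2.1.unpair.2.unpair.1 q.2.1.unpair.2.unpair.2)

theorem computable_fin_aux {V : ℕ → ℕ} (hV : Computable V) {t : ℕ × ℕ × ℕ × ℕ → ℕ}
    (ht : Computable t) :
    Computable (fun q : (ℕ × ℕ) × ℕ × List ℕ => t (V q.1.2, Encodable.encode q.2.2,
      q.2.1.unpair.2.unpair.1, q.2.1.unpair.2.unpair.2)) := by
  have hu : Computable Nat.unpair := Primrec.unpair.to_comp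
  have h : Computable (fun q : (ℕ × ℕ) × ℕ × List ℕ => q.2.1.unpair.2.unpair) :=
    hu.comp (Computable.snd.comp (hu.comp (Computable.fst.comp Computable.snd)))
  exact ht.comp ((hV.comp (Computable.snd.comp Computable.fst)).pair
    ((Computable.encode.comp (Computable.snd.comp Computable.snd)).pair
      ((Computable.fst.comp h).pair (Computable.snd.comp h))))

theorem computable_fin (hM : M.Computable') : Computable (fin M) :=
  computable_fin_aux hM.1.2.2.2.1 hM.2.2.2

theorem exists_step (hM : M.Computable') : ∃ K : OCode, ∀ (O : ℕ → ℕ) (e : ℕ) (g : Config),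
    (∀ w, (OCode.ofNat e).eval O w = Part.some (Encodable.encode (g w))) →
    ∀ v, K.eval (tjump O) (Nat.pair e v) = Part.some (Encodable.encode (M.step g v)) := by
  obtain ⟨c1, hc1⟩ := OCode.exists_of_computable primrec_h1.to_comp
  obtain ⟨k1, rfl⟩ := OCode.ofNat_surj c1
  obtain ⟨c2, hc2⟩ := OCode.exists_of_computable (computable_h2 M hM)
  obtain ⟨k2, rfl⟩ := OCode.ofNat_surj c2
  obtain ⟨cN, hN⟩ := exists_loop M hM k2
  obtain ⟨cf, hcf⟩ := OCode.exists_of_computable (computable_fin M hM)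
  -- search for the old value
  obtain ⟨cq, hq⟩ := OCode.exists_of_computable
    (f := fun n : ℕ => OCode.query k1 n.unpair.1.unpair.1
      (Nat.pair n.unpair.1.unpair.2 n.unpair.2)) (by
      have hu : Computable Nat.unpair := Primrec.unpair.to_comp
      have h1 : Computable (fun n : ℕ => n.unpair.1.unpair) :=
        hu.comp (Computable.fst.comp hu)
      exact (OCode.primrec_query k1).to_comp.comp (Computable.fst.comp h1)
        (Primrec₂.natPair.to_comp.comp (Computable.snd.comp h1) (Computable.snd.comp hu)))
  obtain ⟨cs, hs⟩ := OCode.exists_of_computable (f := fun n : ℕ => 1 - n)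
    (Primrec.nat_sub.comp (Primrec.const 1) Primrec.id).to_comp
  obtain ⟨cy, hy⟩ := OCode.exists_search
    (c := .comp cs (.comp .oracle cq))
    (F := fun J n => 1 - J (OCode.query k1 n.unpair.1.unpair.1
      (Nat.pair n.unpair.1.unpair.2 n.unpair.2))) (by
      intro J n
      refine (OCode.eval_comp_some
        ((OCode.eval_comp_some (hq J n)).trans (OCode.eval_oracle' _ _))).trans ?_
      exact hs J _)
  refine ⟨.comp cf (.pair OCode.idc (.pair cy cN)), fun O e g he v => ?_⟩
  have hyv : cy.eval (tjump O) (Nat.pair e v) = Part.some (Encodable.encode (g v)) := by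
    apply hy
    intro y'
    have := OCode.query_spec (h := h1) hc1 he (Nat.pair v y')
    simp only [Nat.unpair_pair, this]
    have hiff : (∃ w, h1 (Nat.pair v y', w, Encodable.encode (g w)) = 0) ↔
        y' = Encodable.encode (g v) := by
      simp only [h1]
      constructor
      · rintro ⟨w, hw⟩
        by_cases hp : Nat.pair v y' = Nat.pair w (Encodable.encode (g w))
        · rw [Nat.pair_eq_pair] at hp
          obtain ⟨rfl, h⟩ := hp
          exact h
        · simp [hp] at hw
      · intro h
        exact ⟨v, by simp [h]⟩
    rw [← hiff]
    by_cases hh : ∃ w, h1 (Nat.pair v y', w, Encodable.encode (g w)) = 0 <;> simp [hh]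
  refine (OCode.eval_comp_some (OCode.eval_pair_some (OCode.eval_idc _ _)
    (OCode.eval_pair_some hyv (hN (tjump O) e v)))).trans ?_
  refine (hcf (tjump O) ((e, v), Encodable.encode (g v), recv M k2 (tjump O) e v _)).trans ?_
  congr 1
  have hnd : (recv M k2 (tjump O) e v (gl M v).length).Nodup := by
    rw [recv, List.nodup_reverse]
    exact ((lst_spec _).1.sublist (List.take_sublist _ _)).filter _
  have hX : ((Encodable.decode (α := Finset ℕ) (Encodable.encode
      (recv M k2 (tjump O) e v (gl M v).length))).getD ∅) = M.pulses g v := by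
    rw [decode_finset_eq, dif_pos hnd]
    ext c
    have hqs := OCode.query_spec (h := h2 M) hc2 he (Nat.pair v c)
    simp only [h2_eq_zero] at hqs
    simp only [Option.getD_some, Finset.mem_mk, Multiset.mem_coe, recv, List.mem_reverse,
      List.take_length, List.mem_filter, hqs, GraphMachine.pulses, Finset.mem_filter,
      gl, (lst_spec _).2]
    by_cases hh : ∃ w ∈ M.graph.G, c ∈ M.graph.E w v ∧ c ∈ (g w).1 <;> simp [hh]
  change fin M _ = _
  simp only [fin]
  rw [hX, GraphMachine.step]
  have hz : (Encodable.encode (g v)).unpair.2 = Nat.pair (g v).2.1 (g v).2.2 := by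
    rw [Encodable.encode_prod_val, Nat.unpair_pair]
    rfl
  rw [hz, Nat.unpair_pair]

theorem exists_uniform (hM : M.Computable') : ∃ c : OCode, ∀ (f : Config) (n v : ℕ),
    c.eval (tjumpIter (configFn f) n) (Nat.pair n v) =
      Part.some (Encodable.encode (M.run f n v)) := by
  obtain ⟨K, hK⟩ := exists_step M hM
  obtain ⟨k, hk⟩ := OCode.ofNat_surj K
  obtain ⟨i, hi⟩ := OCode.ofNat_surj OCode.idc
  set S : ℕ → ℕ := fun e => OCode.ecomp k (OCode.epair (OCode.econst e) i) with hS
  have hSp : Primrec S := OCode.primrec_ecomp.comp (Primrec.const k)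
    (OCode.primrec_epair.comp OCode.primrec_econst (Primrec.const i))
  let idx : ℕ → ℕ := fun n => Nat.rec 4 (fun _ ih => S ih) n
  have hidx : Primrec idx := Primrec.nat_rec₁ 4 (hSp.comp Primrec.snd).to₂
  have hspec : ∀ f n v, (OCode.ofNat (idx n)).eval (tjumpIter (configFn f) n) v =
      Part.some (Encodable.encode (M.run f n v)) := by
    intro f n
    induction n with
    | zero =>
      intro v
      change (OCode.ofNat 4).eval _ _ = _
      rw [OCode.ofNat_oracle]
      rfl
    | succ n ih =>
      intro v
      change (OCode.ofNat (OCode.ecomp k (OCode.epair (OCode.econst (idx n)) i))).eval _ _ = _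
      rw [OCode.ofNat_ecomp, OCode.ofNat_epair, OCode.ofNat_econst, hk, hi]
      refine (OCode.eval_comp_some (OCode.eval_pair_some (OCode.eval_constc _ _ _)
          (OCode.eval_idc _ _))).trans ?_
      exact hK _ _ _ ih v
  obtain ⟨ck, hck⟩ := OCode.exists_of_computable
    (f := fun q : (ℕ × ℕ) × ℕ => Nat.pair (idx (q.1.1 - 1)) q.1.2)
    (Primrec₂.natPair.comp
      (hidx.comp (Primrec.nat_sub.comp (Primrec.fst.comp Primrec.fst) (Primrec.const 1)))
      (Primrec.snd.comp Primrec.fst)).to_comp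
  obtain ⟨cg, hcg⟩ := OCode.exists_of_computable
    (f := fun q : ℕ × ℕ => Nat.pair (Nat.pair q.1 q.2) (1 - (1 - q.1)))
    (Primrec₂.natPair.comp (Primrec₂.natPair.comp Primrec.fst Primrec.snd)
      (Primrec.nat_sub.comp (Primrec.const 1)
        (Primrec.nat_sub.comp (Primrec.const 1) Primrec.fst))).to_comp
  refine ⟨.comp (.prec (.comp .oracle .right) (.comp K ck)) cg, fun f n v => ?_⟩
  refine (OCode.eval_comp_some (hcg _ (n, v))).trans ?_
  have hbase : ∀ O : ℕ → ℕ, (OCode.comp .oracle .right).eval O (Nat.pair n v) =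
      Part.some (O v) := fun O => by
    rw [OCode.eval_comp_some (OCode.eval_right' _ _), OCode.eval_oracle', Nat.unpair_pair]
  cases n with
  | zero =>
    change (OCode.prec _ _).eval _ (Nat.pair (Nat.pair 0 v) 0) = _
    rw [OCode.eval_prec_zero, hbase]
    rfl
  | succ n =>
    have : (1 - (1 - (n + 1))) = 0 + 1 := by omega
    change (OCode.prec _ _).eval _ (Nat.pair (Nat.pair (n + 1) v) (1 - (1 - (n + 1)))) = _
    rw [this, OCode.eval_prec_succ, OCode.eval_prec_zero, hbase, Part.bind_some]
    refine (OCode.eval_comp_some (hck _ ((n + 1, v), Nat.pair 0 _))).trans ?_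
    exact hK _ _ _ (hspec f n) v

end Step

theorem exists_guard (M : GraphMachine) (hM : M.Computable') : ∃ c : OCode, ∀ O v y,
    c.eval O (Nat.pair v y) = Part.some (if v ∈ M.graph.G then y else 0) := by
  obtain ⟨⟨⟨_, hG⟩, -⟩, -⟩ := hM
  obtain ⟨c, hc⟩ := OCode.exists_of_computable
    (f := fun q : ℕ × ℕ => bif decide (q.1 ∈ M.graph.G) then q.2 else 0)
    (Computable.cond ((hG.comp Computable.fst).of_eq fun q => by simp) Computable.snd
      (Computable.const 0))
  refine ⟨c, fun O v y => (hc O (v, y)).trans ?_⟩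
  by_cases h : v ∈ M.graph.G <;> simp [h]

/-- For a computable graph machine `M` and a valid configuration `f`
of Turing degree `𝐟` (represented by the oracle `configFn f`): each
`f_n = ⟨M,f⟩(·,n)` is `𝐟^(n)`-computable, uniformly in `n`, and consequently the run
`⟨M,f⟩` is `𝐟^(ω)`-computable. -/
theorem stmt5 (M : GraphMachine) (hM : M.Computable') (f : Config) (hf : M.Valid f) :
    (∀ n : ℕ,
      TuringLE (fun v => if v ∈ M.graph.G then Encodable.encode (M.run f n v) else 0)
        (tjumpIter (configFn f) n)) ∧
    (∃ c : OCode, ∀ n : ℕ, ∀ v ∈ M.graph.G,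
        c.eval (tjumpIter (configFn f) n) (Nat.pair n v) =
          Part.some (Encodable.encode (M.run f n v))) ∧
    TuringLE (runFn M f) (omegaIter (configFn f)) := by
  obtain ⟨c, hc⟩ := exists_uniform M hM
  obtain ⟨cg, hg⟩ := exists_guard M hM
  refine ⟨fun n => ?_, ⟨c, fun n v _ => hc f n v⟩, ?_⟩
  · refine ⟨.comp cg (.pair OCode.idc (.comp c (.pair (OCode.constc n) OCode.idc))), fun v => ?_⟩
    rw [OCode.eval_comp_some (OCode.eval_pair_some (OCode.eval_idc _ _)
      ((OCode.eval_comp_some (OCode.eval_pair_some (OCode.eval_constc _ n v)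
        (OCode.eval_idc _ _))).trans (hc f n v))), hg]
  · obtain ⟨c', hc'⟩ := OCode.exists_slice c
    refine ⟨.comp cg (.pair .left (.comp c' (.pair .right (.pair .right .left)))), fun p => ?_⟩
    have h1 : (fun y => omegaIter (configFn f) (Nat.pair p.unpair.2 y)) =
        tjumpIter (configFn f) p.unpair.2 := by
      funext y
      simp [omegaIter]
    have h2 := hc' (omegaIter (configFn f)) p.unpair.2 (Nat.pair p.unpair.2 p.unpair.1)
    rw [h1, hc] at h2
    rw [OCode.eval_comp_some (OCode.eval_pair_some (OCode.eval_left' _ _)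
      ((OCode.eval_comp_some (OCode.eval_pair_some (OCode.eval_right' _ _)
        (OCode.eval_pair_some (OCode.eval_right' _ _) (OCode.eval_left' _ _)))).trans h2)), hg]
    rfl

end
end
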